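/- arXiv:2508.19125 — 4 statements merged into one kernel-verified Lean document; each statement's English description precedes it below -/
import Mathlib

section
/- Let e be a zero of h with e < θ0 and set β_e := −G(e), so β_e > 0. Then D(β) → +∞ as β → β_e from the left, i.e. along the filter of neighborhoods of β_e within (0, β_e). -/
open Real Set Filter MeasureTheory

theorem core_aux (γ Cbar c0 e : ℝ) (hγ : 0 < γ) (hCbar : 0 < Cbar) (hc0 : 0 < c0)
    (g h c G F D : ℝ → ℝ) (hgc : Continuous g) (hcc : Continuous c)
    (hgC : ∀ θ, Cbar ≤ g θ) (hcc0 : ∀ θ, c0 ≤ c θ)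
    (hh : ∀ θ, h θ = γ * Real.sin (θ - e) ^ 2)
    (hGd : ∀ θ, HasDerivAt G (h θ / g θ) θ)
    (hF : Function.LeftInverse F G) (hF' : Function.RightInverse F G)
    (hD : ∀ β : ℝ, D β =
      (∫ t in (0:ℝ)..β, c (F (t - β)) * g (F (t - β)) / h (F (t - β)) / Real.sqrt t) *
      (∫ t in (0:ℝ)..β, c (F (t - β)) / h (F (t - β)) / Real.sqrt t))
    (θ0 : ℝ) (hG0 : G θ0 = 0) (heθ0 : e < θ0) :
    0 < -G e ∧ Tendsto D (nhdsWithin (-G e) (Set.Ioo (0:ℝ) (-G e))) atTop := by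
  have hg0 : ∀ θ, 0 < g θ := fun θ => hCbar.trans_le (hgC θ)
  have hh0 : ∀ θ, 0 ≤ h θ := fun θ => by rw [hh]; positivity
  have hhc : Continuous h := by
    rw [show h = _ from funext hh]; fun_prop
  have hGm : StrictMono G := by
    refine Monotone.strictMono_of_injective ?_ hF.injective
    refine monotone_of_deriv_nonneg (fun θ => (hGd θ).differentiableAt) fun θ => ?_
    rw [(hGd θ).deriv]; exact div_nonneg (hh0 θ) (hg0 θ).le
  have hFm : StrictMono F := by
    intro a b hab
    rw [← hGm.lt_iff_lt, hF', hF']; exact hab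
  have hFc : Continuous F := hFm.monotone.continuous_of_surjective hF.surjective
  have hpos : 0 < -G e := by
    have := hGm heθ0
    linarith
  refine ⟨hpos, ?_⟩
  -- integrability of g/h ∘ F
  have hp : ∀ a b : ℝ, IntervalIntegrable (fun u => g (F u) / h (F u)) volume a b := by
    intro a b
    refine ((hFm.monotone.monotoneOn _).intervalIntegrable_deriv).congr_ae ?_
    refine ae_restrict_of_ae ?_
    have hcount : ({u | h (F u) = 0}).Countable := by
      have h1 : ({θ | h θ = 0}).Countable := by
        refine (Set.countable_range (fun n : ℤ => e + n * π)).mono ?_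
        intro θ hθ
        have hθ' : h θ = 0 := hθ
        rw [hh] at hθ'
        have : Real.sin (θ - e) = 0 := by
          simpa [hγ.ne'] using hθ'
        obtain ⟨n, hn⟩ := Real.sin_eq_zero_iff.1 this
        exact ⟨n, by simp only; linarith⟩
      exact h1.preimage_of_injOn (hFm.injective.injOn)
    filter_upwards [hcount.ae_notMem volume] with u hu
    have hu' : h (F u) ≠ 0 := hu
    have := HasDerivAt.of_local_left_inverse hFc.continuousAt (hGd (F u))
      (div_ne_zero hu' (hg0 _).ne') (Eventually.of_forall hF')
    rw [this.deriv, inv_div]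
  -- cubic lower bound
  obtain ⟨κ, hκ, hcub⟩ : ∃ κ : ℝ, 0 < κ ∧ ∀ θ ∈ Icc e (e+1), κ * (θ - e)^3 ≤ G θ - G e := by
    obtain ⟨M, hM⟩ := (isCompact_Icc (a := e) (b := e+1)).exists_bound_of_continuousOn
      hgc.continuousOn
    have hM' : ∀ θ ∈ Icc e (e+1), g θ ≤ M := fun θ hθ => (le_abs_self _).trans (hM θ hθ)
    have hM0 : 0 < M := (hg0 e).trans_le (hM' e ⟨le_rfl, by linarith⟩)
    refine ⟨γ / (12 * M), by positivity, ?_⟩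
    have hd : ∀ θ, HasDerivAt (fun θ => G θ - γ / (12 * M) * (θ - e)^3)
        (h θ / g θ - γ / (12 * M) * (3 * (θ - e)^2)) θ := by
      intro θ
      have h1 : HasDerivAt (fun θ : ℝ => (θ - e)^3) (3 * (θ - e)^2) θ := by
        have h0 := ((hasDerivAt_id θ).sub_const e).pow 3
        convert! h0 using 1
        simp
      exact (hGd θ).sub (h1.const_mul _)
    have hmono : MonotoneOn (fun θ => G θ - γ / (12 * M) * (θ - e)^3) (Icc e (e+1)) := by
      refine monotoneOn_of_deriv_nonneg (convex_Icc _ _)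
        (fun θ _ => (hd θ).continuousAt.continuousWithinAt)
        (fun θ _ => (hd θ).differentiableAt.differentiableWithinAt) ?_
      intro θ hθ
      have hθ := interior_subset hθ
      rw [(hd θ).deriv, sub_nonneg, hh]
      have hs : (θ - e) / 2 ≤ Real.sin (θ - e) := by
        have h1 := Real.mul_le_sin (x := θ - e) (by linarith [hθ.1])
          (by linarith [hθ.2, Real.pi_gt_three])
        refine le_trans ?_ h1
        have : 1/2 ≤ 2 / π := by
          rw [div_le_div_iff₀ two_pos Real.pi_pos]; linarith [Real.pi_le_four]
        nlinarith [hθ.1]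
      have hs2 : ((θ - e) / 2)^2 ≤ Real.sin (θ - e) ^ 2 :=
        pow_le_pow_left₀ (by linarith [hθ.1]) hs 2
      calc γ / (12 * M) * (3 * (θ - e)^2) = γ * ((θ - e) / 2)^2 / M := by field_simp; ring
        _ ≤ γ * Real.sin (θ - e) ^ 2 / M := by gcongr
        _ ≤ γ * Real.sin (θ - e) ^ 2 / g θ :=
            div_le_div_of_nonneg_left (by positivity) (hg0 _) (hM' _ hθ)
    intro θ hθ
    have := hmono ⟨le_rfl, by linarith⟩ hθ hθ.1
    simp only [sub_self] at this
    norm_num at this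
    linarith
  -- the main estimate
  set A : ℝ := 1 + 3 / κ with hA
  have hA0 : 0 < A := by positivity
  have hA3 : 3 / κ ≤ A ^ 3 := by
    have : 0 < 3 / κ := by positivity
    rw [hA]; nlinarith [pow_pos this 2, pow_pos this 3]
  set B : ℝ := c0 / (γ * A^2 * 2) with hB
  have hB0 : 0 < B := by positivity
  have key : ∀ ε > 0, 3 * ε < G (e+1) - G e → 3 * ε < -G e →
      Cbar * (B^2 * (ε ^ ((1:ℝ)/6))⁻¹) * (ε ^ ((1:ℝ)/6))⁻¹ ≤ D (-G e - ε) := by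
    intro ε hε h1 h2
    set β := -G e - ε with hβ
    obtain ⟨y, hy, hyε⟩ : ∃ y : ℝ, 0 < y ∧ ε = y ^ 6 :=
      ⟨ε ^ ((1:ℝ)/6), by positivity, by rw [← Real.rpow_natCast, ← Real.rpow_mul hε.le]; norm_num⟩
    have hy' : ε ^ ((1:ℝ)/6) = y := by
      rw [hyε, ← Real.rpow_natCast, ← Real.rpow_mul hy.le]; norm_num
    rw [hy']
    have hrange : ∀ t ∈ Icc 0 (2*ε), e < F (t - β) ∧ F (t - β) < e + 1 := by
      intro t ht
      rw [← hGm.lt_iff_lt, ← hGm.lt_iff_lt (b := e+1), hF']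
      constructor <;> linarith [ht.1, ht.2]
    have hhp : ∀ t ∈ Icc 0 (2*ε), 0 < h (F (t - β)) := by
      intro t ht
      have := hrange t ht
      rw [hh]
      have : 0 < Real.sin (F (t - β) - e) :=
        Real.sin_pos_of_pos_of_lt_pi (by linarith) (by linarith [Real.pi_gt_three])
      positivity
    have hFb : Continuous fun t => F (t - β) := hFc.comp (by fun_prop)
    have hgF : Continuous fun t => g (F (t - β)) := hgc.comp hFb
    have hcF : Continuous fun t => c (F (t - β)) := hcc.comp hFb
    have hhF : Continuous fun t => h (F (t - β)) := hhc.comp hFb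
    have hint1 : IntervalIntegrable
        (fun t => c (F (t - β)) * g (F (t - β)) / h (F (t - β)) / Real.sqrt t) volume 0 β := by
      refine IntervalIntegrable.trans (b := 2*ε) ?_ ?_
      · have hs : IntervalIntegrable (fun t : ℝ => t ^ (-(1:ℝ)/2)) volume 0 (2*ε) :=
          intervalIntegral.intervalIntegrable_rpow' (by norm_num)
        have hco : ContinuousOn (fun t => c (F (t - β)) * g (F (t - β)) / h (F (t - β)))
            (uIcc 0 (2*ε)) := by
          rw [uIcc_of_le (by positivity)]
          exact (hcF.mul hgF).continuousOn.div hhF.continuousOn fun t ht => (hhp t ht).ne'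
        refine (hs.continuousOn_mul hco).congr ?_
        intro t ht
        rw [uIoc_of_le (by positivity)] at ht
        simp only
        rw [div_eq_mul_inv _ (Real.sqrt t), Real.sqrt_eq_rpow, ← Real.rpow_neg ht.1.le]
        norm_num
      · have hs := (hp (2*ε - β) 0).comp_sub_right β
        rw [sub_add_cancel, zero_add] at hs
        have hle : 2 * ε ≤ β := by linarith
        have hco : ContinuousOn (fun t => c (F (t - β)) / Real.sqrt t) (uIcc (2*ε) β) := by
          rw [uIcc_of_le hle]
          refine hcF.continuousOn.div Real.continuous_sqrt.continuousOn fun t ht => ?_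
          exact (Real.sqrt_pos.2 (by linarith [ht.1])).ne'
        refine (hs.continuousOn_mul hco).congr ?_
        intro t ht
        simp only
        ring
    have hint2 : IntervalIntegrable
        (fun t => c (F (t - β)) / h (F (t - β)) / Real.sqrt t) volume 0 β := by
      refine (hint1.mul_continuousOn (g := fun t => (g (F (t - β)))⁻¹)
        (hgF.inv₀ fun t => (hg0 _).ne').continuousOn).congr ?_
      intro t ht
      have := (hg0 (F (t - β))).ne'
      simp only
      field_simp
    have hβ0 : 0 ≤ β := by linarith
    have hcp : ∀ θ, 0 < c θ := fun θ => hc0.trans_le (hcc0 θ)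
    have hnn : ∀ t, 0 ≤ c (F (t - β)) / h (F (t - β)) / Real.sqrt t := fun t =>
      div_nonneg (div_nonneg (hcp _).le (hh0 _)) (Real.sqrt_nonneg _)
    have hI12 : Cbar * (∫ t in (0:ℝ)..β, c (F (t - β)) / h (F (t - β)) / Real.sqrt t) ≤
        ∫ t in (0:ℝ)..β, c (F (t - β)) * g (F (t - β)) / h (F (t - β)) / Real.sqrt t := by
      rw [← intervalIntegral.integral_const_mul]
      refine intervalIntegral.integral_mono_on hβ0 (hint2.const_mul _) hint1 fun t _ => ?_
      have := mul_le_mul_of_nonneg_right (hgC (F (t - β))) (hnn t)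
      refine this.trans (le_of_eq (by ring))
    have hI2 : B * y⁻¹ ≤ ∫ t in (0:ℝ)..β, c (F (t - β)) / h (F (t - β)) / Real.sqrt t := by
      have hsub : (∫ t in ε..(2*ε), c (F (t - β)) / h (F (t - β)) / Real.sqrt t) ≤
          ∫ t in (0:ℝ)..β, c (F (t - β)) / h (F (t - β)) / Real.sqrt t :=
        intervalIntegral.integral_mono_interval hε.le (by linarith) (by linarith)
          (Eventually.of_forall hnn) hint2
      refine le_trans ?_ hsub
      have hconst : B * y⁻¹ = ∫ t in ε..(2*ε), c0 / (γ * (A * y^2)^2) / (2 * y^3) := by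
        rw [intervalIntegral.integral_const, smul_eq_mul, hB, hyε]
        field_simp
        ring
      rw [hconst]
      refine intervalIntegral.integral_mono_on (by linarith) (by simp) ?_ ?_
      · refine hint2.mono_set ?_
        rw [uIcc_of_le (by linarith), uIcc_of_le hβ0]
        exact Icc_subset_Icc hε.le (by linarith)
      · intro t ht
        have ht' : t ∈ Icc 0 (2*ε) := ⟨by linarith [ht.1], ht.2⟩
        obtain ⟨hr1, hr2⟩ := hrange t ht'
        have hx : F (t - β) - e ≤ A * y^2 := by
          have h3 := hcub (F (t - β)) ⟨hr1.le, hr2.le⟩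
          rw [hF'] at h3
          have h4 : (F (t - β) - e)^3 ≤ (A * y^2)^3 := by
            have h5 : (F (t - β) - e)^3 ≤ 3 * ε / κ := by
              rw [le_div_iff₀ hκ]; linarith [ht.2]
            calc _ ≤ 3 * ε / κ := h5
              _ = 3 / κ * y^6 := by rw [hyε]; ring
              _ ≤ A^3 * y^6 := by gcongr
              _ = _ := by ring
          exact le_of_pow_le_pow_left₀ (by norm_num) (by positivity) h4
        have hhle : h (F (t - β)) ≤ γ * (A * y^2)^2 := by
          rw [hh]
          have h6 : |Real.sin (F (t - β) - e)| ≤ A * y^2 := by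
            refine (Real.abs_sin_le_abs).trans ?_
            rwa [abs_of_pos (by linarith)]
          rw [← sq_abs]
          gcongr
        have hsq : Real.sqrt t ≤ 2 * y^3 := by
          rw [Real.sqrt_le_left (by positivity)]
          have := ht.2
          rw [hyε] at this
          nlinarith [pow_pos hy 6]
        have hsp : 0 < Real.sqrt t := Real.sqrt_pos.2 (by linarith [ht.1])
        have := hhp t ht'
        have := hcc0 (F (t - β))
        gcongr
        · exact div_nonneg (hcp _).le (hh0 _)
        · exact (hcp _).le
    rw [hD]
    have hBy : 0 < B * y⁻¹ := by positivity
    calc Cbar * (B^2 * y⁻¹) * y⁻¹ = (Cbar * (B * y⁻¹)) * (B * y⁻¹) := by ring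
      _ ≤ _ := by
        refine mul_le_mul (le_trans ?_ hI12) hI2 hBy.le (le_trans ?_ hI12)
        · gcongr
        · exact mul_nonneg hCbar.le (hBy.le.trans hI2)
  -- conclude
  have hlim : Tendsto (fun β => ((-G e - β) ^ ((1:ℝ)/6))) (nhdsWithin (-G e) (Set.Ioo 0 (-G e)))
      (nhdsWithin 0 (Set.Ioi 0)) := by
    refine tendsto_nhdsWithin_iff.2 ⟨?_, ?_⟩
    · have : Continuous (fun β : ℝ => ((-G e - β) ^ ((1:ℝ)/6))) :=
        (by fun_prop : Continuous fun β : ℝ => -G e - β).rpow_const (by intro x; right; norm_num)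
      have h2 := this.tendsto (-G e)
      simp only [sub_self] at h2
      rw [Real.zero_rpow (by norm_num)] at h2
      exact h2.mono_left nhdsWithin_le_nhds
    · filter_upwards [self_mem_nhdsWithin] with β hβ
      exact Real.rpow_pos_of_pos (by linarith [hβ.2]) _
  have hinv := tendsto_inv_nhdsGT_zero.comp hlim
  have hT : Tendsto (fun β => Cbar * (B^2 * ((-G e - β) ^ ((1:ℝ)/6))⁻¹) *
      ((-G e - β) ^ ((1:ℝ)/6))⁻¹) (nhdsWithin (-G e) (Set.Ioo 0 (-G e))) atTop :=
    ((hinv.const_mul_atTop (by positivity : 0 < B^2)).const_mul_atTop hCbar).atTop_mul_atTop₀ hinv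
  refine tendsto_atTop_mono' _ ?_ hT
  have hG1 : 0 < G (e+1) - G e := sub_pos.2 (hGm (by linarith))
  have e1 : ∀ᶠ β in nhdsWithin (-G e) (Set.Ioo 0 (-G e)),
      -G e - (min (G (e+1) - G e) (-G e)) / 3 < β :=
    (lt_mem_nhds (by have := lt_min hG1 hpos; linarith)).filter_mono nhdsWithin_le_nhds
  filter_upwards [self_mem_nhdsWithin, e1] with β hβ hβ1
  have hm1 := min_le_left (G (e+1) - G e) (-G e)
  have hm2 := min_le_right (G (e+1) - G e) (-G e)
  have := key (-G e - β) (by linarith [hβ.2]) (by linarith) (by linarith)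
  rwa [sub_sub_cancel] at this

/-- If `e` is a zero of `h` with `e < θ0` and `β_e := −G(e)`, then
`β_e > 0` and `D(β) → +∞` as `β → β_e` from the left (within `(0, β_e)`). -/
theorem stmt_4
    (α1 α2 α3 α4 α5 α6 K1 K3 γ1 γ2 Cbar θ0 : ℝ)
    (hγ1 : γ1 = α3 - α2) (hγ2 : γ2 = α6 - α5) (hγ1pos : 0 < γ1)
    (hK1 : 0 < K1) (hK3 : 0 < K3) (hCbar : 0 < Cbar)
    (g h c G : ℝ → ℝ)
    (hg : ∀ θ : ℝ, g θ = α1 * Real.sin θ ^ 2 * Real.cos θ ^ 2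
        + (α5 - α2) / 2 * Real.sin θ ^ 2 + (α3 + α6) / 2 * Real.cos θ ^ 2 + α4 / 2)
    (hh : ∀ θ : ℝ, h θ = (γ1 + γ2 * Real.cos (2 * θ)) / 2)
    (hc : ∀ θ : ℝ, c θ = Real.sqrt (K1 * Real.cos θ ^ 2 + K3 * Real.sin θ ^ 2))
    (hdamp : ∀ θ : ℝ, Cbar ≤ g θ - h θ ^ 2 / γ1 ∧ g θ - h θ ^ 2 / γ1 ≤ g θ)
    (hθ0 : h θ0 ≠ 0)
    (hG : ∀ θ : ℝ, G θ = ∫ s in θ0..θ, h s / g s)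
    (hcase : γ2 = γ1 ∨ γ2 = -γ1)
    (F D : ℝ → ℝ)
    (hF : Function.LeftInverse F G) (hF' : Function.RightInverse F G)
    (hD : ∀ β : ℝ, D β =
      (∫ t in (0:ℝ)..β, c (F (t - β)) * g (F (t - β)) / h (F (t - β)) / Real.sqrt t) *
      (∫ t in (0:ℝ)..β, c (F (t - β)) / h (F (t - β)) / Real.sqrt t))
    (e : ℝ) (he : h e = 0) (heθ0 : e < θ0) :
    0 < -G e ∧ Tendsto D (nhdsWithin (-G e) (Set.Ioo (0:ℝ) (-G e))) atTop := by
  have hg0 : ∀ θ, Cbar ≤ g θ := fun θ => (hdamp θ).1.trans (hdamp θ).2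
  have hgc : Continuous g := by
    rw [show g = _ from funext hg]; fun_prop
  have hcc : Continuous c := by
    rw [show c = _ from funext hc]; fun_prop
  have hhc : Continuous h := by
    rw [show h = _ from funext hh]; fun_prop
  have hm : 0 < min K1 K3 := lt_min hK1 hK3
  refine core_aux γ1 Cbar (Real.sqrt (min K1 K3)) e hγ1pos hCbar (Real.sqrt_pos.2 hm) g h c G F D
    hgc hcc hg0 ?_ ?_ ?_ hF hF' hD θ0 (by rw [hG]; simp) heθ0
  · intro θ
    rw [hc]
    refine Real.sqrt_le_sqrt ?_
    have h1 := mul_le_mul_of_nonneg_right (min_le_left K1 K3) (sq_nonneg (Real.cos θ))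
    have h2 := mul_le_mul_of_nonneg_right (min_le_right K1 K3) (sq_nonneg (Real.sin θ))
    have h3 := Real.sin_sq_add_cos_sq θ
    calc min K1 K3 = min K1 K3 * (Real.sin θ ^ 2 + Real.cos θ ^ 2) := by rw [h3, mul_one]
      _ ≤ _ := by linarith
  · intro θ
    rw [hh] at he ⊢
    have hexp : Real.cos (2 * θ) = Real.cos (2 * (θ - e)) * Real.cos (2 * e)
        - Real.sin (2 * (θ - e)) * Real.sin (2 * e) := by
      rw [← Real.cos_add]; congr 1; ring
    have hsc := Real.sin_sq_add_cos_sq (2 * e)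
    have hdbl : Real.cos (2 * (θ - e)) = 1 - 2 * Real.sin (θ - e) ^ 2 := by
      rw [Real.cos_two_mul]; linarith [Real.sin_sq_add_cos_sq (θ - e)]
    have hc2 : γ2 * Real.cos (2 * e) = -γ1 := by linarith
    have hs2 : Real.sin (2 * e) = 0 := by
      have : Real.cos (2 * e) ^ 2 = 1 := by
        have h1 : γ1 ^ 2 * Real.cos (2 * e) ^ 2 = γ1 ^ 2 * 1 := by
          have : γ2 ^ 2 = γ1 ^ 2 := by rcases hcase with h | h <;> rw [h] <;> ring
          calc _ = (γ2 * Real.cos (2 * e)) ^ 2 := by rw [mul_pow, this]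
            _ = _ := by rw [hc2]; ring
        exact mul_left_cancel₀ (by positivity) h1
      have h0 : Real.sin (2 * e) ^ 2 = 0 := by linarith
      exact pow_eq_zero_iff (two_ne_zero) |>.1 h0
    rw [hexp, hs2, hdbl]
    linear_combination (1 - 2 * Real.sin (θ - e) ^ 2) / 2 * hc2
  · intro θ
    rw [show G = _ from funext hG]
    have : Continuous fun s => h s / g s := hhc.div hgc fun s => (hCbar.trans_le (hg0 s)).ne'
    exact (this.integral_hasStrictDerivAt θ0 θ).hasDerivAt
end

section
/- For every ū > 0, the map (u, θ) ↦ −G(θ(1/2)) is a bijection from the set of stationary solutions of the boundary value problem onto the set {β > 0 : β ≠ −G(e) for every zero e of h, and 2D(β) = ū}. -/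
open Real Set Filter MeasureTheory

/-- A stationary solution of the shear-flow boundary value problem: a pair of C²
functions `(u, θ)` satisfying `(g(θ)u′)′ = 0` and `c(θ)(c(θ)θ′)′ − h(θ)u′ = 0` on
`[0,1]`, with `u(0) = 0`, `u(1) = ū`, `θ(0) = θ(1) = θ0`. -/
def IsStationarySolution (g h c : ℝ → ℝ) (θ0 ub : ℝ) (u th : ℝ → ℝ) : Prop :=
  ContDiff ℝ 2 u ∧ ContDiff ℝ 2 th ∧
  (∀ x ∈ Set.Icc (0:ℝ) 1, deriv (fun y => g (th y) * deriv u y) x = 0) ∧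
  (∀ x ∈ Set.Icc (0:ℝ) 1,
    c (th x) * deriv (fun y => c (th y) * deriv th y) x - h (th x) * deriv u x = 0) ∧
  u 0 = 0 ∧ u 1 = ub ∧ th 0 = θ0 ∧ th 1 = θ0

/-- The first order system on `[p,q]`. -/
def SysOn (k c : ℝ → ℝ) (p q : ℝ) (θ v : ℝ → ℝ) : Prop :=
  ∀ x ∈ Set.Icc p q, HasDerivAt θ (v x / c (θ x)) x ∧ HasDerivAt v (k (θ x)) x

lemma SysOn.mono {k c : ℝ → ℝ} {p q p' q' : ℝ} {θ v : ℝ → ℝ} (S : SysOn k c p q θ v)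
    (hp : p ≤ p') (hq : q' ≤ q) : SysOn k c p' q' θ v :=
  fun x hx => S x ⟨hp.trans hx.1, hx.2.trans hq⟩

lemma vf_contDiff {k c : ℝ → ℝ} {n : WithTop ℕ∞} (hk : ContDiff ℝ n k) (hc : ContDiff ℝ n c)
    (hcpos : ∀ x, 0 < c x) (R : ℝ) :
    ContDiff ℝ n (fun p : ℝ × ℝ => (p.2 / (R * c (R * p.1)), k (R * p.1))) ∨ R = 0 := by
  by_cases hR : R = 0
  · exact Or.inr hR
  left
  refine ContDiff.prodMk (ContDiff.div contDiff_snd ?_ ?_) ?_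
  · exact contDiff_const.mul (hc.comp (contDiff_const.mul contDiff_fst))
  · intro x; exact mul_ne_zero hR (hcpos _).ne'
  · exact hk.comp (contDiff_const.mul contDiff_fst)

lemma sys_unique {k c : ℝ → ℝ} (hk : ContDiff ℝ 1 k) (hc : ContDiff ℝ 1 c)
    (hcpos : ∀ x, 0 < c x) {p q : ℝ} {θ₁ v₁ θ₂ v₂ : ℝ → ℝ}
    (S₁ : SysOn k c p q θ₁ v₁) (S₂ : SysOn k c p q θ₂ v₂) {t₀ : ℝ} (ht : t₀ ∈ Ioo p q)
    (hθ : θ₁ t₀ = θ₂ t₀) (hv : v₁ t₀ = v₂ t₀) :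
    ∀ x ∈ Icc p q, θ₁ x = θ₂ x ∧ v₁ x = v₂ x := by
  have hV : ContDiff ℝ 1 (fun p : ℝ × ℝ => (p.2 / c p.1, k p.1)) := by
    have := (vf_contDiff hk hc hcpos 1).resolve_right one_ne_zero
    simpa using this
  have d₁ : ∀ x ∈ Icc p q, HasDerivAt (fun x => (θ₁ x, v₁ x)) (v₁ x / c (θ₁ x), k (θ₁ x)) x :=
    fun x hx => (S₁ x hx).1.prodMk (S₁ x hx).2
  have d₂ : ∀ x ∈ Icc p q, HasDerivAt (fun x => (θ₂ x, v₂ x)) (v₂ x / c (θ₂ x), k (θ₂ x)) x :=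
    fun x hx => (S₂ x hx).1.prodMk (S₂ x hx).2
  have c₁ : ContinuousOn (fun x => (θ₁ x, v₁ x)) (Icc p q) :=
    fun x hx => (d₁ x hx).continuousAt.continuousWithinAt
  have c₂ : ContinuousOn (fun x => (θ₂ x, v₂ x)) (Icc p q) :=
    fun x hx => (d₂ x hx).continuousAt.continuousWithinAt
  have b := (isCompact_Icc.image_of_continuousOn c₁).union (isCompact_Icc.image_of_continuousOn c₂)
  obtain ⟨r, hr⟩ := b.isBounded.subset_closedBall (0 : ℝ × ℝ)
  obtain ⟨K, hK⟩ := (hV.contDiffOn (s := Metric.closedBall (0 : ℝ × ℝ) r)).exists_lipschitzOnWith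
    one_ne_zero (convex_closedBall _ _) (isCompact_closedBall _ _)
  have := ODE_solution_unique_of_mem_Icc (v := fun _ (p : ℝ × ℝ) => (p.2 / c p.1, k p.1))
    (s := fun _ => Metric.closedBall (0 : ℝ × ℝ) r) (K := K)
    (fun _ _ => hK) ht c₁ (fun t ht => d₁ t (Ioo_subset_Icc_self ht))
    (fun t ht => hr (Or.inl (mem_image_of_mem _ (Ioo_subset_Icc_self ht)))) c₂
    (fun t ht => d₂ t (Ioo_subset_Icc_self ht))
    (fun t ht => hr (Or.inr (mem_image_of_mem _ (Ioo_subset_Icc_self ht)))) (by simp [hθ, hv])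
  intro x hx
  have h := this hx
  simpa using h

lemma sys_reflect {k c : ℝ → ℝ} {p q m : ℝ} {θ v : ℝ → ℝ} (S : SysOn k c p q θ v) :
    SysOn k c (m - q) (m - p) (fun x => θ (m - x)) (fun x => -v (m - x)) := by
  intro x hx
  have hx' : m - x ∈ Icc p q := ⟨by linarith [hx.2], by linarith [hx.1]⟩
  obtain ⟨h1, h2⟩ := S _ hx'
  have e : HasDerivAt (fun x => m - x) (-1) x := by
    simpa using (hasDerivAt_id x).const_sub m
  constructor
  · exact (h1.comp x e).congr_deriv (by ring)
  · exact (h2.comp x e).neg.congr_deriv (by ring)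

lemma sys_exists {k c : ℝ → ℝ} (hk : ContDiff ℝ 2 k) (hc : ContDiff ℝ 2 c)
    {M cm : ℝ} (hcm : 0 < cm) (hcpos : ∀ x, cm ≤ c x) (hkM : ∀ x, |k x| ≤ M) (hM : 0 < M)
    (θm : ℝ) :
    ∃ θ v : ℝ → ℝ, ContDiff ℝ 2 θ ∧ SysOn k c 0 1 θ v ∧ θ (1/2) = θm ∧ v (1/2) = 0 := by
  have hcp : ∀ x, 0 < c x := fun x => hcm.trans_le (hcpos x)
  set R : ℝ := 1 / cm with hR
  have hRpos : 0 < R := by positivity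
  have hV := (vf_contDiff hk hc hcp R).resolve_right hRpos.ne'
  set x₀ : ℝ × ℝ := (θm / R, 0) with hx₀
  obtain ⟨K, hK⟩ := (hV.contDiffOn (s := Metric.closedBall x₀ M)).exists_lipschitzOnWith
    two_ne_zero (convex_closedBall _ _) (isCompact_closedBall _ _)
  have hmem : (1/2 : ℝ) ∈ Icc (-1/2 : ℝ) (3/2) := by constructor <;> norm_num
  have PL : IsPicardLindelof (fun _ (p : ℝ × ℝ) => (p.2 / (R * c (R * p.1)), k (R * p.1)))
      (⟨1/2, hmem⟩ : Icc (-1/2 : ℝ) (3/2)) x₀ M.toNNReal 0 M.toNNReal K := by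
    constructor
    · intro t _
      rw [Real.coe_toNNReal M hM.le]; exact hK
    · intro x _; exact continuousOn_const
    · intro t _ x hx
      rw [Real.coe_toNNReal M hM.le] at hx ⊢
      rw [Metric.mem_closedBall, dist_eq_norm, Prod.norm_def] at hx
      have h2 : |x.2| ≤ M := by
        have := (le_max_right _ _).trans hx
        simpa [hx₀] using this
      rw [Prod.norm_def]
      refine max_le ?_ (hkM _)
      have h3 : 1 ≤ R * c (R * x.1) := by
        rw [hR, div_mul_eq_mul_div, le_div_iff₀ hcm]; linarith [hcpos (1 / cm * x.1)]
      simp only [Real.norm_eq_abs, abs_div]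
      rw [abs_of_pos (a := R * _) (by linarith)]
      exact (div_le_self (abs_nonneg _) h3).trans h2
    · rw [Real.coe_toNNReal M hM.le]
      norm_num
  obtain ⟨α, hα0, hα⟩ := PL.exists_eq_forall_mem_Icc_hasDerivWithinAt₀
  have hα' : ∀ t ∈ Ioo (-1/2 : ℝ) (3/2),
      HasDerivAt α ((α t).2 / (R * c (R * (α t).1)), k (R * (α t).1)) t :=
    fun t ht => (hα t (Ioo_subset_Icc_self ht)).hasDerivAt (Icc_mem_nhds ht.1 ht.2)
  -- smoothness
  have s0 : ContDiffOn ℝ 2 α (Ioo (-1/2 : ℝ) (3/2)) := by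
    have hd : DifferentiableOn ℝ α (Ioo (-1/2 : ℝ) (3/2)) := fun t ht =>
      (hα' t ht).differentiableAt.differentiableWithinAt
    have hder : ∀ t ∈ Ioo (-1/2 : ℝ) (3/2), deriv α t =
      ((fun p : ℝ × ℝ => (p.2 / (R * c (R * p.1)), k (R * p.1))) ∘ α) t :=
      fun t ht => (hα' t ht).deriv
    have s1 : ContDiffOn ℝ 1 α (Ioo (-1/2 : ℝ) (3/2)) := by
      rw [show (1 : WithTop ℕ∞) = 0 + 1 by norm_num, contDiffOn_succ_iff_deriv_of_isOpen isOpen_Ioo]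
      refine ⟨hd, by simp, ?_⟩
      refine ContDiffOn.congr ?_ hder
      rw [contDiffOn_zero]
      exact hV.continuous.comp_continuousOn hd.continuousOn
    rw [show (2 : WithTop ℕ∞) = 1 + 1 by norm_num, contDiffOn_succ_iff_deriv_of_isOpen isOpen_Ioo]
    refine ⟨hd, by simp, ?_⟩
    refine ContDiffOn.congr ?_ hder
    exact (hV.of_le (by norm_num)).comp_contDiffOn s1
  let χ : ContDiffBump (1/2 : ℝ) := ⟨3/4, 7/8, by norm_num, by norm_num⟩
  refine ⟨fun x => χ x * (R * (α x).1), fun x => (α x).2, ?_, ?_, ?_, ?_⟩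
  · rw [contDiff_iff_contDiffAt]
    intro x
    by_cases hx : x ∈ Ioo (-1/2 : ℝ) (3/2)
    · exact χ.contDiffAt.mul (contDiffAt_const.mul
        ((s0.contDiffAt (isOpen_Ioo.mem_nhds hx)).fst))
    · have : x ∉ tsupport χ := by
        rw [χ.tsupport_eq, Real.closedBall_eq_Icc]
        intro h; apply hx
        have h1 := h.1; have h2 := h.2
        simp only [χ] at h1 h2
        constructor <;> linarith
      rw [notMem_tsupport_iff_eventuallyEq] at this
      refine (contDiffAt_const (c := (0:ℝ))).congr_of_eventuallyEq ?_
      filter_upwards [this] with y hy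
      simp [hy]
  · intro x hx
    have hx' : x ∈ Ioo (-1/2 : ℝ) (3/2) := ⟨by linarith [hx.1], by linarith [hx.2]⟩
    have h1 : ∀ᶠ y in nhds x, χ y = 1 := by
      have : Ioo (-1/4 : ℝ) (5/4) ∈ nhds x :=
        Ioo_mem_nhds (by linarith [hx.1]) (by linarith [hx.2])
      filter_upwards [this] with y hy
      apply χ.one_of_mem_closedBall
      rw [Real.closedBall_eq_Icc]
      constructor <;> simp only [χ] <;> linarith [hy.1, hy.2]
    have hx1 := h1.self_of_nhds
    have hd := hα' x hx'
    have hf : HasDerivAt (fun y => (α y).1) _ x := hd.fst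
    have hs : HasDerivAt (fun y => (α y).2) _ x := hd.snd
    simp only [hx1, one_mul]
    refine ⟨?_, hs⟩
    have := hf.const_mul R
    have e : R * ((α x).2 / (R * c (R * (α x).1))) = (α x).2 / c (R * (α x).1) := by
      have := (hcp (R * (α x).1)).ne'
      field_simp
    rw [e] at this
    refine this.congr_of_eventuallyEq ?_
    filter_upwards [h1] with y hy
    simp [hy]
  · have : χ (1/2 : ℝ) = 1 := χ.one_of_mem_closedBall (Metric.mem_closedBall_self (by norm_num [χ]))
    have h2 : α (1/2) = x₀ := hα0
    simp only [this, h2, hx₀]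
    field_simp
  · have h2 : α (1/2) = x₀ := hα0
    simp only [h2, hx₀]

lemma sys_contθ {k c : ℝ → ℝ} {p q : ℝ} {θ v : ℝ → ℝ} (S : SysOn k c p q θ v) :
    ContinuousOn θ (Icc p q) := fun x hx => (S x hx).1.continuousAt.continuousWithinAt

lemma sys_contv {k c : ℝ → ℝ} {p q : ℝ} {θ v : ℝ → ℝ} (S : SysOn k c p q θ v) :
    ContinuousOn v (Icc p q) := fun x hx => (S x hx).2.continuousAt.continuousWithinAt

lemma half_pos_v {k c : ℝ → ℝ} (hk0 : ∀ x, 0 ≤ k x) {p q : ℝ} {θ v : ℝ → ℝ}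
    (S : SysOn k c p q θ v) (hv : v p = 0) (hkp : k (θ p) ≠ 0) :
    ∀ x ∈ Ioc p q, 0 < v x := by
  have hmono : MonotoneOn v (Icc p q) := by
    apply monotoneOn_of_deriv_nonneg (convex_Icc p q) (sys_contv S)
    · intro x hx
      exact (S x (interior_subset hx)).2.differentiableAt.differentiableWithinAt
    · intro x hx
      rw [(S x (interior_subset hx)).2.deriv]; exact hk0 _
  intro x hx
  by_contra hneg
  push Not at hneg
  have hpq : p ≤ q := hx.1.le.trans hx.2
  have hz : ∀ y ∈ Icc p x, v y = 0 := by
    intro y hy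
    have hy' : y ∈ Icc p q := ⟨hy.1, hy.2.trans hx.2⟩
    have h1 := hmono ⟨le_rfl, hpq⟩ hy' hy.1
    have h2 := hmono hy' ⟨hx.1.le, hx.2⟩ hy.2
    linarith
  have d1 : HasDerivWithinAt v 0 (Icc p x) p :=
    (hasDerivWithinAt_const p (Icc p x) (0:ℝ)).congr hz (hz p ⟨le_rfl, hx.1.le⟩)
  have d2 := (S p ⟨le_rfl, hpq⟩).2.hasDerivWithinAt (s := Icc p x)
  have := (uniqueDiffOn_Icc hx.1 p ⟨le_rfl, hx.1.le⟩).eq_deriv _ d1 d2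
  exact hkp this.symm

lemma half_strictMono {k c : ℝ → ℝ} (hk0 : ∀ x, 0 ≤ k x) (hcpos : ∀ x, 0 < c x) {p q : ℝ}
    {θ v : ℝ → ℝ} (S : SysOn k c p q θ v) (hv : v p = 0) (hkp : k (θ p) ≠ 0) :
    StrictMonoOn θ (Icc p q) := by
  apply strictMonoOn_of_deriv_pos (convex_Icc p q) (sys_contθ S)
  intro x hx
  rw [interior_Icc] at hx
  rw [(S x (Ioo_subset_Icc_self hx)).1.deriv]
  exact div_pos (half_pos_v hk0 S hv hkp x ⟨hx.1, hx.2.le⟩) (hcpos _)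

lemma sys_energy {g h c G : ℝ → ℝ} {a : ℝ} 
    (hGd : ∀ x, HasDerivAt G (h x / g x) x) {p q : ℝ}
    {θ v : ℝ → ℝ} (S : SysOn (fun x => a * (h x / (g x * c x))) c p q θ v) (hv : v p = 0) :
    ∀ x ∈ Icc p q, v x ^ 2 = 2 * a * (G (θ x) - G (θ p)) := by
  have hd : ∀ x ∈ Icc p q, HasDerivAt (fun x => v x ^ 2 - 2 * a * G (θ x)) 0 x := by
    intro x hx
    have h1 := (S x hx).2.pow 2
    have h2 := ((hGd (θ x)).comp x (S x hx).1).const_mul (2 * a)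
    refine (h1.sub h2).congr_deriv ?_
    simp only [div_eq_mul_inv, mul_inv]
    push_cast
    ring
  have := constant_of_has_deriv_right_zero (a := p) (b := q)
    (f := fun x => v x ^ 2 - 2 * a * G (θ x))
    (fun x hx => (hd x hx).continuousAt.continuousWithinAt)
    (fun x hx => (hd x (Ico_subset_Icc_self hx)).hasDerivWithinAt)
  intro x hx
  have := this x hx
  simp only [hv] at this
  linarith

lemma half_int {g h c G F : ℝ → ℝ} {a : ℝ} (ha : 0 < a) (hgpos : ∀ x, 0 < g x)
    (hcpos : ∀ x, 0 < c x) (hh0 : ∀ x, 0 ≤ h x) (hz : {e | h e = 0}.Countable)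
    (hGd : ∀ x, HasDerivAt G (h x / g x) x) (hGm : StrictMono G) (hF : Function.LeftInverse F G)
    {p q β : ℝ} (hpq : p ≤ q)
    {θ v : ℝ → ℝ} (S : SysOn (fun x => a * (h x / (g x * c x))) c p q θ v) (hv : v p = 0)
    (hhp : h (θ p) ≠ 0) (hβ : G (θ p) = -β) (N : ℝ → ℝ) :
    ∫ t in (0:ℝ)..(G (θ q) + β), N (F (t - β)) / h (F (t - β)) / √t =
      ∫ x in p..q, √(2 * a) * (N (θ x) / (c (θ x) * g (θ x))) := by
  have hk0 : ∀ x, 0 ≤ (fun x => a * (h x / (g x * c x))) x := fun x =>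
    mul_nonneg ha.le (div_nonneg (hh0 x) (mul_pos (hgpos x) (hcpos x)).le)
  have hkp : (fun x => a * (h x / (g x * c x))) (θ p) ≠ 0 :=
    mul_ne_zero ha.ne' (div_ne_zero hhp (mul_pos (hgpos _) (hcpos _)).ne')
  have vpos := half_pos_v hk0 S hv hkp
  have θm := half_strictMono hk0 hcpos S hv hkp
  have en := sys_energy hGd S hv
  set f : ℝ → ℝ := fun x => G (θ x) + β with hf
  have fm : StrictMonoOn f (Icc p q) := fun x hx y hy hxy =>
    add_lt_add_left (hGm (θm hx hy hxy)) β
  have fd : ∀ x ∈ Icc p q, HasDerivAt f (h (θ x) / g (θ x) * (v x / c (θ x))) x := fun x hx =>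
    ((hGd (θ x)).comp x (S x hx).1).add_const β
  have fp : f p = 0 := by simp [hf, hβ]
  have fcont : ContinuousOn f (Icc p q) := fun x hx => (fd x hx).continuousAt.continuousWithinAt
  have fq : 0 ≤ f q := fp ▸ fm.monotoneOn ⟨le_rfl, hpq⟩ ⟨hpq, le_rfl⟩ hpq
  have him : f '' Ioo p q = Ioo 0 (f q) := by
    apply Subset.antisymm
    · rintro _ ⟨x, hx, rfl⟩
      have hx' := Ioo_subset_Icc_self hx
      exact ⟨fp ▸ fm ⟨le_rfl, hpq⟩ hx' hx.1, fm hx' ⟨hpq, le_rfl⟩ hx.2⟩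
    · rw [← fp]; exact intermediate_value_Ioo hpq fcont
  have hcount : (Ioo p q ∩ {x | h (θ x) = 0}).Countable := by
    refine MapsTo.countable_of_injOn (f := θ) (t := {e | h e = 0}) (fun x hx => hx.2) ?_ hz
    exact θm.injOn.mono (inter_subset_left.trans Ioo_subset_Icc_self)
  change ∫ t in (0:ℝ)..(f q), N (F (t - β)) / h (F (t - β)) / √t = _
  rw [intervalIntegral.integral_of_le fq, intervalIntegral.integral_of_le hpq,
    integral_Ioc_eq_integral_Ioo, integral_Ioc_eq_integral_Ioo, ← him,
    integral_image_eq_integral_abs_deriv_smul measurableSet_Ioo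
      (fun x hx => (fd x (Ioo_subset_Icc_self hx)).hasDerivWithinAt)
      (fm.injOn.mono Ioo_subset_Icc_self)]
  apply integral_congr_ae
  rw [EventuallyEq, ae_restrict_iff' measurableSet_Ioo]
  have hnull := hcount.ae_notMem volume
  filter_upwards [hnull] with x hx hxI
  have hxI' := Ioo_subset_Icc_self hxI
  have hhx : h (θ x) ≠ 0 := fun h0 => hx ⟨hxI, h0⟩
  have e1 : F (f x - β) = θ x := by simp only [hf, add_sub_cancel_right]; exact hF _
  have vx := vpos x ⟨hxI.1, hxI.2.le⟩
  have fx : 0 < f x := fp ▸ fm ⟨le_rfl, hpq⟩ hxI' hxI.1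
  have ev : v x = √(2 * a) * √(f x) := by
    rw [← Real.sqrt_mul (by positivity), ← Real.sqrt_sq vx.le, en x hxI', hβ]
    simp [hf]
  have hg' := hgpos (θ x)
  have hc' := hcpos (θ x)
  have hh' := lt_of_le_of_ne (hh0 (θ x)) (Ne.symm hhx)
  have hs := Real.sqrt_pos.2 fx
  rw [e1, smul_eq_mul, abs_of_pos (by positivity), ev]
  field_simp

lemma not_left {k c : ℝ → ℝ} (hk : ContDiff ℝ 1 k) (hc : ContDiff ℝ 1 c) (hk0 : ∀ x, 0 ≤ k x)
    (hcpos : ∀ x, 0 < c x) {θ v : ℝ → ℝ} (S : SysOn k c 0 1 θ v) (hend : θ 0 = θ 1)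
    {m : ℝ} (hm : m ∈ Ioo (0:ℝ) 1) (hv : v m = 0) (hkm : k (θ m) ≠ 0) : 1/2 ≤ m := by
  by_contra hlt
  push Not at hlt
  have S1 : SysOn k c 0 (2 * m) θ v := S.mono le_rfl (by linarith)
  have S2 : SysOn k c 0 (2 * m) (fun x => θ (2 * m - x)) (fun x => -v (2 * m - x)) := by
    have := sys_reflect (m := 2 * m) S1
    simpa using this
  have e : 2 * m - m = m := by ring
  have hU := sys_unique hk hc hcpos S1 S2 (t₀ := m) ⟨hm.1, by linarith [hm.1]⟩
    (by simp [e]) (by simp [e, hv]) 0 ⟨le_rfl, by linarith [hm.1]⟩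
  have h1 : θ 0 = θ (2 * m) := by simpa using hU.1
  have S3 : SysOn k c m 1 θ v := S.mono hm.1.le le_rfl
  have := half_strictMono hk0 hcpos S3 hv hkm (a := 2 * m) (b := 1)
    ⟨by linarith [hm.1], by linarith⟩ ⟨hm.2.le, le_rfl⟩ (by linarith)
  linarith

lemma sys_symm {k c : ℝ → ℝ} (hk : ContDiff ℝ 1 k) (hc : ContDiff ℝ 1 c)
    (hcpos : ∀ x, 0 < c x) {θ v : ℝ → ℝ} (S : SysOn k c 0 1 θ v) (hv : v (1/2) = 0) :
    ∀ x ∈ Icc (0:ℝ) 1, θ x = θ (1 - x) := by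
  have S2 : SysOn k c 0 1 (fun x => θ (1 - x)) (fun x => -v (1 - x)) := by
    have := sys_reflect (m := 1) S
    simpa using this
  have e : (1:ℝ) - 1/2 = 1/2 := by norm_num
  intro x hx
  exact (sys_unique hk hc hcpos S S2 (t₀ := 1/2) ⟨by norm_num, by norm_num⟩
    (by simp only [e]) (by simp only [e, hv, neg_zero]) x hx).1

lemma mid_zero {k c : ℝ → ℝ} (hk : ContDiff ℝ 1 k) (hc : ContDiff ℝ 1 c) (hk0 : ∀ x, 0 ≤ k x)
    (hcpos : ∀ x, 0 < c x) {θ v : ℝ → ℝ} (S : SysOn k c 0 1 θ v) (hend : θ 0 = θ 1)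
    (hk1 : k (θ 1) ≠ 0) : v (1/2) = 0 ∧ k (θ (1/2)) ≠ 0 := by
  obtain ⟨m, hm, hd⟩ := exists_deriv_eq_zero zero_lt_one (sys_contθ S) hend
  rw [(S m (Ioo_subset_Icc_self hm)).1.deriv] at hd
  have hv : v m = 0 := by
    rcases div_eq_zero_iff.1 hd with h | h
    · exact h
    · exact absurd h (hcpos _).ne'
  have hkm : k (θ m) ≠ 0 := by
    intro h0
    have S2 : SysOn k c 0 1 (fun _ => θ m) (fun _ => 0) := by
      intro x _
      simp only [zero_div, h0]
      exact ⟨hasDerivAt_const _ _, hasDerivAt_const _ _⟩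
    have := (sys_unique hk hc hcpos S S2 hm rfl hv 1 ⟨zero_le_one, le_rfl⟩).1
    rw [this] at hk1
    exact hk1 h0
  have h1 := not_left hk hc hk0 hcpos S hend hm hv hkm
  have S2 : SysOn k c 0 1 (fun x => θ (1 - x)) (fun x => -v (1 - x)) := by
    have := sys_reflect (m := 1) S
    simpa using this
  have h2 := not_left hk hc hk0 hcpos S2 (by simpa using hend.symm) (m := 1 - m)
    ⟨by linarith [hm.2], by linarith [hm.1]⟩ (by simp [hv]) (by simpa using hkm)
  have : m = 1/2 := by linarith
  subst this
  exact ⟨hv, hkm⟩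

lemma deriv_contDiff_one {f : ℝ → ℝ} (hf : ContDiff ℝ 2 f) : ContDiff ℝ 1 (deriv f) := by
  rw [show (2 : WithTop ℕ∞) = 1 + 1 by norm_num, contDiff_succ_iff_deriv] at hf
  exact hf.2.2

lemma st_to_sys {g h c : ℝ → ℝ} (hg : ContDiff ℝ 2 g) (hc : ContDiff ℝ 2 c)
    (hgpos : ∀ x, 0 < g x) (hcpos : ∀ x, 0 < c x) {θ0 ub : ℝ} (hub : 0 < ub) {u th : ℝ → ℝ}
    (H : IsStationarySolution g h c θ0 ub u th) :
    ∃ a : ℝ, 0 < a ∧ (∀ x ∈ Icc (0:ℝ) 1, HasDerivAt u (a / g (th x)) x) ∧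
      ∃ v : ℝ → ℝ, SysOn (fun x => a * (h x / (g x * c x))) c 0 1 th v := by
  obtain ⟨hu, hth, e1, e2, u0, u1, t0, t1⟩ := H
  have hu' := deriv_contDiff_one hu
  have hth' := deriv_contDiff_one hth
  have hth1 : ContDiff ℝ 1 th := hth.of_le (by norm_num)
  have hP : ContDiff ℝ 1 (fun y => g (th y) * deriv u y) :=
    ((hg.of_le (by norm_num)).comp hth1).mul hu'
  have hv : ContDiff ℝ 1 (fun y => c (th y) * deriv th y) :=
    ((hc.of_le (by norm_num)).comp hth1).mul hth'
  have hconst := constant_of_has_deriv_right_zero (a := 0) (b := 1)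
    (f := fun y => g (th y) * deriv u y) hP.continuous.continuousOn
    (fun x hx => by
      have := ((hP.differentiable one_ne_zero) x).hasDerivAt
      rw [e1 x (Ico_subset_Icc_self hx)] at this
      exact this.hasDerivWithinAt)
  set a := g (th 0) * deriv u 0 with ha
  have hder : ∀ x ∈ Icc (0:ℝ) 1, deriv u x = a / g (th x) := by
    intro x hx
    rw [eq_div_iff (hgpos _).ne', ← hconst x hx]; ring
  have hapos : 0 < a := by
    obtain ⟨ξ, hξ, hs⟩ := exists_deriv_eq_slope u zero_lt_one hu.continuous.continuousOn
      (hu.differentiable two_ne_zero).differentiableOn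
    rw [hder ξ (Ioo_subset_Icc_self hξ), u0, u1, div_eq_iff (hgpos _).ne'] at hs
    rw [hs]
    have := hgpos (th ξ)
    norm_num
    positivity
  refine ⟨a, hapos, ?_, fun y => c (th y) * deriv th y, ?_⟩
  · intro x hx
    rw [← hder x hx]
    exact ((hu.differentiable two_ne_zero) x).hasDerivAt
  · intro x hx
    constructor
    · have := ((hth.differentiable two_ne_zero) x).hasDerivAt
      refine this.congr_deriv ?_
      rw [mul_div_cancel_left₀ _ (hcpos _).ne']
    · have := ((hv.differentiable one_ne_zero) x).hasDerivAt
      refine this.congr_deriv ?_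
      have h2 := e2 x hx
      rw [hder x hx] at h2
      have hc' := (hcpos (th x)).ne'
      have hg' := (hgpos (th x)).ne'
      field_simp at h2 ⊢
      linarith

lemma sys_vals {g h c G F : ℝ → ℝ} {a : ℝ} (ha : 0 < a) (hg : ContDiff ℝ 2 g)
    (hh : ContDiff ℝ 2 h) (hc : ContDiff ℝ 2 c) (hgpos : ∀ x, 0 < g x)
    (hcpos : ∀ x, 0 < c x) (hh0 : ∀ x, 0 ≤ h x) (hz : {e | h e = 0}.Countable)
    (hGd : ∀ x, HasDerivAt G (h x / g x) x) (hGm : StrictMono G) (hF : Function.LeftInverse F G)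
    {β : ℝ} {u θ v : ℝ → ℝ} (S : SysOn (fun x => a * (h x / (g x * c x))) c 0 1 θ v)
    (hu : ∀ x ∈ Icc (0:ℝ) 1, HasDerivAt u (a / g (θ x)) x)
    (hv : v (1/2) = 0)
    (hhp : h (θ (1/2)) ≠ 0) (hβ : G (θ (1/2)) = -β) :
    (∫ t in (0:ℝ)..(G (θ 1) + β), c (F (t - β)) * g (F (t - β)) / h (F (t - β)) / √t
      = √(2 * a) / 2) ∧
    (∫ t in (0:ℝ)..(G (θ 1) + β), c (F (t - β)) / h (F (t - β)) / √t
      = √(2 * a) / a * ((u 1 - u 0) / 2)) := by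
  have S1 : SysOn (fun x => a * (h x / (g x * c x))) c (1/2) 1 θ v :=
    S.mono (by norm_num) le_rfl
  have key := half_int ha hgpos hcpos hh0 hz hGd hGm hF (by norm_num) S1 hv hhp hβ
  constructor
  · have := key (fun x => c x * g x)
    rw [this]
    have e : ∀ x, (c (θ x) * g (θ x)) / (c (θ x) * g (θ x)) = 1 := fun x =>
      div_self (mul_pos (hcpos _) (hgpos _)).ne'
    simp only [e, mul_one, intervalIntegral.integral_const, smul_eq_mul]
    ring
  · rw [key c]
    have e : ∀ x, √(2 * a) * (c (θ x) / (c (θ x) * g (θ x))) = √(2 * a) / a * (a / g (θ x)) := by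
      intro x
      have := (hcpos (θ x)).ne'
      have := (hgpos (θ x)).ne'
      field_simp
    simp only [e]
    rw [intervalIntegral.integral_const_mul]
    have hsub : Icc (1/2 : ℝ) 1 ⊆ Icc 0 1 := Icc_subset_Icc_left (by norm_num)
    have huI : uIcc (1/2 : ℝ) 1 = Icc (1/2) 1 := uIcc_of_le (by norm_num)
    have ftc : ∫ x in (1/2 : ℝ)..1, a / g (θ x) = u 1 - u (1/2) := by
      apply intervalIntegral.integral_eq_sub_of_hasDerivAt
      · intro x hx
        rw [huI] at hx
        exact hu x (hsub hx)
      · apply ContinuousOn.intervalIntegrable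
        rw [huI]
        refine ContinuousOn.div continuousOn_const
          (hg.continuous.comp_continuousOn ((sys_contθ S).mono hsub)) (fun x _ => (hgpos _).ne')
    have hks : ContDiff ℝ 1 (fun x => a * (h x / (g x * c x))) :=
      (contDiff_const.mul (hh.div (hg.mul hc) (fun x => (mul_pos (hgpos x) (hcpos x)).ne'))).of_le
        (by norm_num)
    have sym := sys_symm hks (hc.of_le (by norm_num)) hcpos S hv
    have hd : ∀ x ∈ Icc (0:ℝ) 1, HasDerivAt (fun x => u x + u (1 - x)) 0 x := by
      intro x hx
      have e : HasDerivAt (fun x : ℝ => 1 - x) (-1) x := by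
        simpa using (hasDerivAt_id x).const_sub 1
      have h1 := hu (1 - x) ⟨by linarith [hx.2], by linarith [hx.1]⟩
      refine ((hu x hx).add (h1.comp x e)).congr_deriv ?_
      rw [← sym x hx]; ring
    have := constant_of_has_deriv_right_zero (a := 0) (b := 1)
      (f := fun x => u x + u (1 - x))
      (fun x hx => (hd x hx).continuousAt.continuousWithinAt)
      (fun x hx => (hd x (Ico_subset_Icc_self hx)).hasDerivWithinAt) (1/2)
      ⟨by norm_num, by norm_num⟩
    norm_num at this
    rw [ftc]
    congr 1
    norm_num
    linarith

lemma int_inj {w : ℝ → ℝ} (hw0 : ∀ t, 0 ≤ w t) (hwz : {t | 0 < t ∧ w t = 0}.Countable) {x y J : ℝ}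
    (hx : 0 ≤ x) (hxy : x < y) (hJ : J ≠ 0) (h1 : ∫ t in (0:ℝ)..x, w t = J)
    (h2 : ∫ t in (0:ℝ)..y, w t = J) : False := by
  have i2 : IntervalIntegrable w volume 0 y := by
    by_contra hn
    rw [intervalIntegral.integral_undef hn] at h2
    exact hJ h2.symm
  have i1 : IntervalIntegrable w volume 0 x := i2.mono_set (by
    rw [uIcc_of_le hx, uIcc_of_le (hx.trans hxy.le)]; exact Icc_subset_Icc_right hxy.le)
  have i3 : IntervalIntegrable w volume x y := i1.symm.trans i2
  have hz : ∫ t in x..y, w t = 0 := by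
    have := intervalIntegral.integral_add_adjacent_intervals i1 i3
    linarith
  have hpos : 0 < ∫ t in x..y, w t := by
    rw [intervalIntegral.integral_pos_iff_support_of_nonneg_ae (Eventually.of_forall hw0) i3]
    refine ⟨hxy, ?_⟩
    have hs : Ioc x y \ {t | 0 < t ∧ w t = 0} ⊆ Function.support w ∩ Ioc x y := by
      intro t ht
      refine ⟨fun h0 => ht.2 ⟨hx.trans_lt ht.1.1, h0⟩, ht.1⟩
    refine lt_of_lt_of_le ?_ (measure_mono hs)
    rw [measure_sdiff_null (hwz.measure_zero _)]
    simpa using hxy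
  linarith

theorem main_abs {g h c G F D : ℝ → ℝ} {θ0 ub cm M : ℝ} (hub : 0 < ub) (hg : ContDiff ℝ 2 g)
    (hh : ContDiff ℝ 2 h) (hc : ContDiff ℝ 2 c) (hgpos : ∀ x, 0 < g x)
    (hcm : 0 < cm) (hcle : ∀ x, cm ≤ c x) (hM : 0 < M) (hkM : ∀ x, h x / (g x * c x) ≤ M)
    (hh0 : ∀ x, 0 ≤ h x) (hz : {e | h e = 0}.Countable)
    (hGd : ∀ x, HasDerivAt G (h x / g x) x) (hGm : StrictMono G) (hF : Function.LeftInverse F G)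
    (hF' : Function.RightInverse F G) (hG0 : G θ0 = 0) (hθ0 : h θ0 ≠ 0)
    (hD : ∀ β : ℝ, D β =
      (∫ t in (0:ℝ)..β, c (F (t - β)) * g (F (t - β)) / h (F (t - β)) / Real.sqrt t) *
      (∫ t in (0:ℝ)..β, c (F (t - β)) / h (F (t - β)) / Real.sqrt t)) :
    (∀ u th : ℝ → ℝ, IsStationarySolution g h c θ0 ub u th →
      0 < -G (th (1/2)) ∧ (∀ e : ℝ, h e = 0 → -G (th (1/2)) ≠ -G e) ∧
        2 * D (-G (th (1/2))) = ub) ∧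
    (∀ β : ℝ, 0 < β → (∀ e : ℝ, h e = 0 → β ≠ -G e) → 2 * D β = ub →
      ∃ u th : ℝ → ℝ, IsStationarySolution g h c θ0 ub u th ∧ -G (th (1/2)) = β) ∧
    (∀ u₁ th₁ u₂ th₂ : ℝ → ℝ, IsStationarySolution g h c θ0 ub u₁ th₁ →
      IsStationarySolution g h c θ0 ub u₂ th₂ → -G (th₁ (1/2)) = -G (th₂ (1/2)) →
      Set.EqOn u₁ u₂ (Set.Icc (0:ℝ) 1) ∧ Set.EqOn th₁ th₂ (Set.Icc (0:ℝ) 1)) := by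
  have hcpos : ∀ x, 0 < c x := fun x => hcm.trans_le (hcle x)
  have hgc : ∀ x, g x * c x ≠ 0 := fun x => (mul_pos (hgpos x) (hcpos x)).ne'
  have hks : ∀ a : ℝ, ContDiff ℝ 2 (fun x => a * (h x / (g x * c x))) := fun a =>
    contDiff_const.mul (hh.div (hg.mul hc) hgc)
  have hks1 : ∀ a : ℝ, ContDiff ℝ 1 (fun x => a * (h x / (g x * c x))) := fun a =>
    (hks a).of_le (by norm_num)
  have hc1 : ContDiff ℝ 1 c := hc.of_le (by norm_num)
  have hr0 : ∀ x, 0 ≤ h x / (g x * c x) := fun x =>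
    div_nonneg (hh0 x) (mul_pos (hgpos x) (hcpos x)).le
  have hk0 : ∀ a : ℝ, 0 < a → ∀ x, 0 ≤ a * (h x / (g x * c x)) := fun a ha x =>
    mul_nonneg ha.le (hr0 x)
  -- everything about a stationary solution
  have info : ∀ u th : ℝ → ℝ, IsStationarySolution g h c θ0 ub u th →
      ∃ a : ℝ, 0 < a ∧ (∀ x ∈ Icc (0:ℝ) 1, HasDerivAt u (a / g (th x)) x) ∧
      ∃ v : ℝ → ℝ, SysOn (fun x => a * (h x / (g x * c x))) c 0 1 th v ∧ v (1/2) = 0 ∧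
        h (th (1/2)) ≠ 0 ∧
        (∫ t in (0:ℝ)..(-G (th (1/2))), c (F (t - (-G (th (1/2))))) * g (F (t - (-G (th (1/2)))))
            / h (F (t - (-G (th (1/2))))) / √t = √(2 * a) / 2) ∧
        (∫ t in (0:ℝ)..(-G (th (1/2))), c (F (t - (-G (th (1/2)))))
            / h (F (t - (-G (th (1/2))))) / √t = √(2 * a) / a * (ub / 2)) := by
    intro u th H
    obtain ⟨a, ha, hu, v, S⟩ := st_to_sys hg hc hgpos hcpos hub H
    obtain ⟨-, -, -, -, u0, u1, t0, t1⟩ := H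
    have hk1 : a * (h (th 1) / (g (th 1) * c (th 1))) ≠ 0 := by
      rw [t1]; exact mul_ne_zero ha.ne' (div_ne_zero hθ0 (hgc _))
    obtain ⟨hv, hkm⟩ := mid_zero (hks1 a) hc1 (hk0 a ha) hcpos S (t0.trans t1.symm) hk1
    have hhm : h (th (1/2)) ≠ 0 := by
      intro h0; apply hkm; simp only [h0, zero_div, mul_zero]
    have vals := sys_vals (β := -G (th (1/2))) ha hg hh hc hgpos hcpos hh0 hz hGd hGm hF S hu hv hhm
      (by ring)
    rw [t1, hG0, u1, u0, zero_add, sub_zero] at vals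
    exact ⟨a, ha, hu, v, S, hv, hhm, vals⟩
  refine ⟨?_, ?_, ?_⟩
  · intro u th H
    obtain ⟨a, ha, hu, v, S, hv, hhm, I1, I2⟩ := info u th H
    obtain ⟨-, -, -, -, u0, u1, t0, t1⟩ := H
    refine ⟨?_, ?_, ?_⟩
    · have S1 : SysOn (fun x => a * (h x / (g x * c x))) c (1/2) 1 th v :=
        S.mono (by norm_num) le_rfl
      have := half_strictMono (hk0 a ha) hcpos S1 hv
        (mul_ne_zero ha.ne' (div_ne_zero hhm (hgc _)))
        (a := 1/2) (b := 1) ⟨le_rfl, by norm_num⟩ ⟨by norm_num, le_rfl⟩ (by norm_num)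
      have := hGm this
      rw [t1, hG0] at this
      linarith
    · intro e he hne
      have := hGm.injective (neg_injective hne)
      rw [this] at hhm
      exact hhm he
    · rw [hD, I1, I2]
      have := Real.mul_self_sqrt (show 0 ≤ 2 * a by linarith)
      field_simp
      nlinarith
  · intro β hβ hne h2D
    rw [hD] at h2D
    set w : ℝ → ℝ := fun t => c (F (t - β)) * g (F (t - β)) / h (F (t - β)) / √t with hw
    set I1 : ℝ := ∫ t in (0:ℝ)..β, w t with hI1
    set I2 : ℝ := ∫ t in (0:ℝ)..β, c (F (t - β)) / h (F (t - β)) / √t with hI2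
    have hw0 : ∀ t, 0 ≤ w t := fun t =>
      div_nonneg (div_nonneg (mul_pos (hcpos _) (hgpos _)).le (hh0 _)) (Real.sqrt_nonneg _)
    have hwz : {t | 0 < t ∧ w t = 0}.Countable := by
      refine (hz.image (fun e => G e + β)).mono ?_
      rintro t ⟨ht, hwt⟩
      refine ⟨F (t - β), ?_, ?_⟩
      · by_contra hn
        refine absurd hwt (div_ne_zero (div_ne_zero ?_ hn) (Real.sqrt_pos.2 ht).ne')
        exact (mul_pos (hcpos _) (hgpos _)).ne'
      · change G (F (t - β)) + β = t
        rw [hF']; ring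
    have hI1ne : I1 ≠ 0 := by
      intro h0; rw [h0] at h2D; simp at h2D; exact hub.ne h2D
    have hI1nn : 0 ≤ I1 := intervalIntegral.integral_nonneg hβ.le (fun t _ => hw0 t)
    have hI1p : 0 < I1 := lt_of_le_of_ne hI1nn hI1ne.symm
    set a : ℝ := 2 * I1 ^ 2 with hadef
    have ha : 0 < a := by positivity
    have hsq : √(2 * a) = 2 * I1 := by
      rw [hadef, show 2 * (2 * I1 ^ 2) = (2 * I1) ^ 2 by ring, Real.sqrt_sq (by positivity)]
    obtain ⟨θ, v, hθs, S, hθm, hv⟩ := sys_exists (hks a) hc (M := a * M) hcm hcle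
      (fun x => by
        rw [abs_of_nonneg (hk0 a ha x)]
        exact mul_le_mul_of_nonneg_left (hkM x) ha.le) (by positivity) (F (-β))
    have hGm' : G (θ (1/2)) = -β := by rw [hθm, hF']
    have hhm : h (θ (1/2)) ≠ 0 := by
      intro h0
      exact hne _ h0 (by rw [hGm']; ring)
    have hcontq : Continuous (fun x => a / g (θ x)) :=
      continuous_const.div (hg.continuous.comp hθs.continuous) (fun x => (hgpos _).ne')
    set u : ℝ → ℝ := fun x => ∫ t in (0:ℝ)..x, a / g (θ t) with hudef
    have hud : ∀ x, HasDerivAt u (a / g (θ x)) x := fun x =>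
      intervalIntegral.integral_hasDerivAt_right (hcontq.intervalIntegrable _ _)
        hcontq.stronglyMeasurable.stronglyMeasurableAtFilter hcontq.continuousAt
    have hu0 : u 0 = 0 := by simp [hudef]
    obtain ⟨v1, v2⟩ := sys_vals ha hg hh hc hgpos hcpos hh0 hz hGd hGm hF S (fun x _ => hud x) hv
      hhm hGm'
    have v1' : ∫ t in (0:ℝ)..(G (θ 1) + β), w t = I1 := by
      rw [hw, v1, hsq]; ring
    have hfq : 0 ≤ G (θ 1) + β := by
      have S1 : SysOn (fun x => a * (h x / (g x * c x))) c (1/2) 1 θ v :=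
        S.mono (by norm_num) le_rfl
      have := half_strictMono (hk0 a ha) hcpos S1 hv
        (mul_ne_zero ha.ne' (div_ne_zero hhm (hgc _)))
        (a := 1/2) (b := 1) ⟨le_rfl, by norm_num⟩ ⟨by norm_num, le_rfl⟩ (by norm_num)
      have := hGm this
      linarith
    have hfin : G (θ 1) + β = β := by
      rcases lt_trichotomy (G (θ 1) + β) β with hlt | heq | hgt
      · exact (int_inj hw0 hwz hfq hlt hI1ne v1' hI1.symm).elim
      · exact heq
      · exact (int_inj hw0 hwz hβ.le hgt hI1ne hI1.symm v1').elim
    have ht1 : θ 1 = θ0 := hGm.injective (by rw [hG0]; linarith)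
    have ht0 : θ 0 = θ0 := by
      have := sys_symm (hks1 a) hc1 hcpos S hv 0 ⟨le_rfl, zero_le_one⟩
      rw [this, sub_zero, ht1]
    have hu1 : u 1 = ub := by
      rw [hfin, ← hI2, hsq, hu0, sub_zero] at v2
      rw [v2] at h2D
      rw [← h2D, hadef]
      field_simp
    have hud' : deriv u = fun x => a / g (θ x) := funext fun x => (hud x).deriv
    refine ⟨u, θ, ⟨?_, hθs, ?_, ?_, hu0, hu1, ht0, ht1⟩, by rw [hGm']; ring⟩
    · rw [show (2 : WithTop ℕ∞) = 1 + 1 by norm_num, contDiff_succ_iff_deriv]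
      refine ⟨fun x => (hud x).differentiableAt, by simp, ?_⟩
      rw [hud']
      exact (contDiff_const.div (hg.comp hθs) (fun x => (hgpos _).ne')).of_le (by norm_num)
    · intro x _
      have : (fun y => g (θ y) * deriv u y) = fun _ => a := by
        funext y
        rw [hud']
        exact mul_div_cancel₀ _ (hgpos _).ne'
      rw [this]; simp
    · intro x hx
      have hθ' := deriv_contDiff_one hθs
      have hW : ContDiff ℝ 1 (fun y => c (θ y) * deriv θ y) :=
        (hc1.comp (hθs.of_le (by norm_num))).mul hθ'
      have d1 := ((hW.differentiable one_ne_zero) x).hasDerivAt.hasDerivWithinAt (s := Icc 0 1)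
      have hEq : ∀ y ∈ Icc (0:ℝ) 1, c (θ y) * deriv θ y = v y := by
        intro y hy
        rw [(S y hy).1.deriv]
        exact mul_div_cancel₀ _ (hcpos _).ne'
      have d2 := ((S x hx).2.hasDerivWithinAt (s := Icc 0 1)).congr hEq (hEq x hx)
      have := (uniqueDiffOn_Icc zero_lt_one x hx).eq_deriv _ d1 d2
      rw [this, hud']
      have := (hcpos (θ x)).ne'
      have := (hgpos (θ x)).ne'
      field_simp
      ring
  · intro u₁ th₁ u₂ th₂ H₁ H₂ hE
    obtain ⟨a₁, ha₁, hu₁, v₁, S₁, hv₁, hhm₁, I₁, -⟩ := info u₁ th₁ H₁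
    obtain ⟨a₂, ha₂, hu₂, v₂, S₂, hv₂, hhm₂, I₂, -⟩ := info u₂ th₂ H₂
    rw [hE, I₂] at I₁
    have haa : a₁ = a₂ := by
      have h1 : √(2 * a₂) = √(2 * a₁) := by linarith
      rw [Real.sqrt_inj (by linarith) (by linarith)] at h1
      linarith
    subst haa
    have hmid : th₁ (1/2) = th₂ (1/2) := hGm.injective (neg_injective hE)
    have U := sys_unique (hks1 a₁) hc1 hcpos S₁ S₂ (t₀ := 1/2) ⟨by norm_num, by norm_num⟩ hmid
      (hv₁.trans hv₂.symm)
    refine ⟨?_, fun x hx => (U x hx).1⟩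
    have hd : ∀ x ∈ Icc (0:ℝ) 1, HasDerivAt (fun x => u₁ x - u₂ x) 0 x := by
      intro x hx
      refine ((hu₁ x hx).sub (hu₂ x hx)).congr_deriv ?_
      rw [(U x hx).1]; ring
    have := constant_of_has_deriv_right_zero (a := 0) (b := 1)
      (f := fun x => u₁ x - u₂ x)
      (fun x hx => (hd x hx).continuousAt.continuousWithinAt)
      (fun x hx => (hd x (Ico_subset_Icc_self hx)).hasDerivWithinAt)
    intro x hx
    have h1 := this x hx
    obtain ⟨-, -, -, -, u01, -⟩ := H₁
    obtain ⟨-, -, -, -, u02, -⟩ := H₂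
    simp only [u01, u02] at h1
    linarith

/-- For every `ū > 0`, the map `(u, θ) ↦ −G(θ(1/2))` is a one-to-one
correspondence between stationary solutions of the boundary value problem and the
set `{β > 0 : β ≠ −G(e) for every zero e of h, 2D(β) = ū}`: it maps into the set,
is onto it, and two stationary solutions with the same value of `−G(θ(1/2))`
coincide on `[0,1]`. -/
theorem stmt_8
    (α1 α2 α3 α4 α5 α6 K1 K3 γ1 γ2 Cbar θ0 : ℝ)
    (hγ1 : γ1 = α3 - α2) (hγ2 : γ2 = α6 - α5) (hγ1pos : 0 < γ1)
    (hK1 : 0 < K1) (hK3 : 0 < K3) (hCbar : 0 < Cbar)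
    (g h c G : ℝ → ℝ)
    (hg : ∀ θ : ℝ, g θ = α1 * Real.sin θ ^ 2 * Real.cos θ ^ 2
        + (α5 - α2) / 2 * Real.sin θ ^ 2 + (α3 + α6) / 2 * Real.cos θ ^ 2 + α4 / 2)
    (hh : ∀ θ : ℝ, h θ = (γ1 + γ2 * Real.cos (2 * θ)) / 2)
    (hc : ∀ θ : ℝ, c θ = Real.sqrt (K1 * Real.cos θ ^ 2 + K3 * Real.sin θ ^ 2))
    (hdamp : ∀ θ : ℝ, Cbar ≤ g θ - h θ ^ 2 / γ1 ∧ g θ - h θ ^ 2 / γ1 ≤ g θ)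
    (hθ0 : h θ0 ≠ 0)
    (hG : ∀ θ : ℝ, G θ = ∫ s in θ0..θ, h s / g s)
    (hcase : γ2 = γ1 ∨ γ2 = -γ1)
    (F D : ℝ → ℝ)
    (hF : Function.LeftInverse F G) (hF' : Function.RightInverse F G)
    (hD : ∀ β : ℝ, D β =
      (∫ t in (0:ℝ)..β, c (F (t - β)) * g (F (t - β)) / h (F (t - β)) / Real.sqrt t) *
      (∫ t in (0:ℝ)..β, c (F (t - β)) / h (F (t - β)) / Real.sqrt t))
    (ub : ℝ) (hub : 0 < ub) :
    (∀ u th : ℝ → ℝ, IsStationarySolution g h c θ0 ub u th →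
      0 < -G (th (1/2)) ∧ (∀ e : ℝ, h e = 0 → -G (th (1/2)) ≠ -G e) ∧
        2 * D (-G (th (1/2))) = ub) ∧
    (∀ β : ℝ, 0 < β → (∀ e : ℝ, h e = 0 → β ≠ -G e) → 2 * D β = ub →
      ∃ u th : ℝ → ℝ, IsStationarySolution g h c θ0 ub u th ∧ -G (th (1/2)) = β) ∧
    (∀ u₁ th₁ u₂ th₂ : ℝ → ℝ, IsStationarySolution g h c θ0 ub u₁ th₁ →
      IsStationarySolution g h c θ0 ub u₂ th₂ → -G (th₁ (1/2)) = -G (th₂ (1/2)) →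
      Set.EqOn u₁ u₂ (Set.Icc (0:ℝ) 1) ∧ Set.EqOn th₁ th₂ (Set.Icc (0:ℝ) 1)) := by
  have hgpos : ∀ x, 0 < g x := fun x =>
    hCbar.trans_le ((hdamp x).1.trans (hdamp x).2)
  have hgs : ContDiff ℝ 2 g := by
    rw [show g = _ from funext hg]
    fun_prop
  have hhs : ContDiff ℝ 2 h := by
    rw [show h = _ from funext hh]
    fun_prop
  have hrad : ∀ x : ℝ, min K1 K3 ≤ K1 * Real.cos x ^ 2 + K3 * Real.sin x ^ 2 := by
    intro x
    have h1 := Real.sin_sq_add_cos_sq x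
    nlinarith [min_le_left K1 K3, min_le_right K1 K3, sq_nonneg (Real.sin x),
      sq_nonneg (Real.cos x)]
  have hmin : 0 < min K1 K3 := lt_min hK1 hK3
  have hcs : ContDiff ℝ 2 c := by
    rw [show c = _ from funext hc]
    refine ContDiff.sqrt (by fun_prop) (fun x => (hmin.trans_le (hrad x)).ne')
  have hcle : ∀ x, √(min K1 K3) ≤ c x := fun x => by
    rw [hc]; exact Real.sqrt_le_sqrt (hrad x)
  have hcm : 0 < √(min K1 K3) := Real.sqrt_pos.2 hmin
  have hh0 : ∀ x, 0 ≤ h x := by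
    intro x
    rw [hh]
    have h1 := Real.neg_one_le_cos (2 * x)
    have h2 := Real.cos_le_one (2 * x)
    rcases hcase with e | e <;> rw [e] <;> nlinarith
  have hhle : ∀ x, h x ≤ γ1 := by
    intro x
    rw [hh]
    have h1 := Real.neg_one_le_cos (2 * x)
    have h2 := Real.cos_le_one (2 * x)
    rcases hcase with e | e <;> rw [e] <;> nlinarith
  have hz : {e | h e = 0}.Countable := by
    refine (countable_range (fun n : ℤ => (n : ℝ) * π / 2)).mono ?_
    intro e he
    have he' : h e = 0 := he
    rw [hh] at he'
    have hcos : Real.cos (2 * e) ^ 2 = 1 := by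
      rcases hcase with e1 | e1
      · have : Real.cos (2 * e) = -1 := by
          rw [e1] at he'
          have : γ1 * (Real.cos (2 * e) + 1) = 0 := by linarith
          rcases mul_eq_zero.1 this with h | h
          · exact absurd h hγ1pos.ne'
          · linarith
        rw [this]; norm_num
      · have : Real.cos (2 * e) = 1 := by
          rw [e1] at he'
          have : γ1 * (Real.cos (2 * e) - 1) = 0 := by linarith
          rcases mul_eq_zero.1 this with h | h
          · exact absurd h hγ1pos.ne'
          · linarith
        rw [this]; norm_num
    have hsin : Real.sin (2 * e) = 0 := by
      have := Real.sin_sq_add_cos_sq (2 * e)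
      have : Real.sin (2 * e) ^ 2 = 0 := by linarith
      exact pow_eq_zero_iff two_ne_zero |>.1 this
    obtain ⟨n, hn⟩ := Real.sin_eq_zero_iff.1 hsin
    exact ⟨n, by simp only [hn]; ring⟩
  have hq : Continuous (fun s => h s / g s) :=
    hhs.continuous.div hgs.continuous (fun x => (hgpos x).ne')
  have hGd : ∀ x, HasDerivAt G (h x / g x) x := by
    intro x
    rw [show G = _ from funext hG]
    exact intervalIntegral.integral_hasDerivAt_right (hq.intervalIntegrable _ _)
        hq.stronglyMeasurable.stronglyMeasurableAtFilter hq.continuousAt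
  have hGm : StrictMono G := by
    refine Monotone.strictMono_of_injective ?_ hF.injective
    refine monotone_of_deriv_nonneg (fun x => (hGd x).differentiableAt) (fun x => ?_)
    rw [(hGd x).deriv]
    exact div_nonneg (hh0 x) (hgpos x).le
  refine main_abs (cm := √(min K1 K3)) (M := γ1 / (Cbar * √(min K1 K3))) hub hgs hhs hcs hgpos hcm
    hcle (by positivity) ?_ hh0 hz hGd hGm hF hF' ?_ hθ0 hD
  · intro x
    exact div_le_div₀ hγ1pos.le (hhle x) (by positivity)
      (mul_le_mul ((hdamp x).1.trans (hdamp x).2) (hcle x) hcm.le (hgpos x).le)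
  · rw [hG]; simp
end

section
/- There exists ū0 > 0 such that for every ū > ū0 the stationary boundary value problem admits at least two distinct stationary solutions, i.e. there exist stationary solutions (u1, θ1) and (u2, θ2) with (u1, θ1) ≠ (u2, θ2). -/
open Real Set Filter MeasureTheory

lemma hasDerivAt_fst' {z : ℝ → ℝ × ℝ} {w : ℝ × ℝ} {t : ℝ} (h : HasDerivAt z w t) :
    HasDerivAt (fun s => (z s).1) w.1 t := by
  simpa using h.hasFDerivAt.fst.hasDerivAt

lemma hasDerivAt_snd' {z : ℝ → ℝ × ℝ} {w : ℝ × ℝ} {t : ℝ} (h : HasDerivAt z w t) :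
    HasDerivAt (fun s => (z s).2) w.2 t := by
  simpa using h.hasFDerivAt.snd.hasDerivAt

lemma field_lip (F : ℝ → ℝ) (K : NNReal) (hF : LipschitzWith K F) :
    LipschitzWith (max 1 K) (fun z : ℝ × ℝ => (z.2, F z.1)) := by
  have h1 : LipschitzWith 1 (fun z : ℝ × ℝ => z.2) := LipschitzWith.prod_snd
  have h2 : LipschitzWith (K * 1) (fun z : ℝ × ℝ => F z.1) := hF.comp LipschitzWith.prod_fst
  simpa using h1.prodMk h2

lemma local_exists (F : ℝ → ℝ) (K : NNReal) (hF : LipschitzWith K F) (M : ℝ) (hM : 0 ≤ M)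
    (hFM : ∀ x, |F x| ≤ M) (a N : ℝ) (hN : 0 < N) :
    ∃ z : ℝ → ℝ × ℝ, z 0 = (a, 0) ∧
      ∀ t ∈ Ioo (-N) N, HasDerivAt z ((z t).2, F (z t).1) t := by
  let V : ℝ × ℝ → ℝ × ℝ := fun z => (N⁻¹ * z.2, N * F z.1)
  have hP : IsPicardLindelof (fun _ => V) (tmin := -N) (tmax := N) ⟨0, by simp [hN.le]⟩ (a, 0)
      (⟨M * N ^ 2, by positivity⟩) 0 ⟨M * N, by positivity⟩
      (max (‖N⁻¹‖₊ * 1) (‖N‖₊ * (K * 1))) := by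
    apply IsPicardLindelof.of_time_independent
    · rintro ⟨p, q⟩ hpq
      rw [mem_closedBall_iff_norm] at hpq
      have hq : |q| ≤ M * N ^ 2 := by
        have := (norm_snd_le ((p, q) - (a, (0:ℝ)))).trans hpq
        simp only [Prod.snd_sub, sub_zero, Real.norm_eq_abs] at this
        exact this
      change max |N⁻¹ * q| |N * F p| ≤ M * N
      rw [abs_mul, abs_mul, abs_of_pos hN, abs_of_pos (inv_pos.mpr hN)]
      apply max_le
      · calc N⁻¹ * |q| ≤ N⁻¹ * (M * N ^ 2) := by gcongr
          _ = M * N := by field_simp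
      · nlinarith [hFM p]
    · apply LipschitzWith.lipschitzOnWith
      apply LipschitzWith.prodMk
      · exact (lipschitzWith_smul (N⁻¹ : ℝ)).comp LipschitzWith.prod_snd
      · exact (lipschitzWith_smul (N : ℝ)).comp (hF.comp LipschitzWith.prod_fst)
    · simp
      change M * N * N ≤ M * N ^ 2
      nlinarith
  obtain ⟨α, h0, hα⟩ := hP.exists_eq_forall_mem_Icc_hasDerivWithinAt₀
  refine ⟨fun t => ((α t).1, N⁻¹ * (α t).2), by simp at h0; simp [h0], fun t ht => ?_⟩
  have hd := (hα t ⟨ht.1.le, ht.2.le⟩).hasDerivAt (Icc_mem_nhds ht.1 ht.2)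
  have h1 : HasDerivAt (fun t => (α t).1) (N⁻¹ * (α t).2) t := by
    exact hasDerivAt_fst' hd
  have h2 : HasDerivAt (fun t => (α t).2) (N * F (α t).1) t := by
    exact hasDerivAt_snd' hd
  have := h1.prodMk (h2.const_mul N⁻¹)
  convert this using 2
  field_simp

lemma flow_exists (F : ℝ → ℝ) (K : NNReal) (hF : LipschitzWith K F) (M : ℝ) (hM : 0 ≤ M)
    (hFM : ∀ x, |F x| ≤ M) (a : ℝ) :
    ∃ z : ℝ → ℝ × ℝ, z 0 = (a, 0) ∧ ∀ t, HasDerivAt z ((z t).2, F (z t).1) t := by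
  have H : ∀ n : ℝ, ∃ z : ℝ → ℝ × ℝ, z 0 = (a, 0) ∧
      (0 < n → ∀ t ∈ Ioo (-n) n, HasDerivAt z ((z t).2, F (z t).1) t) := by
    intro n
    by_cases hn : 0 < n
    · obtain ⟨z, h1, h2⟩ := local_exists F K hF M hM hFM a n hn
      exact ⟨z, h1, fun _ => h2⟩
    · exact ⟨fun _ => (a, 0), rfl, fun h => absurd h hn⟩
  choose Z hZ0 hZ using H
  have huniq : ∀ n m : ℝ, 0 < n → n ≤ m → EqOn (Z n) (Z m) (Ioo (-n) n) := by
    intro n m hn hm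
    refine ODE_solution_unique_of_mem_Ioo (v := fun _ z => (z.2, F z.1)) (s := fun _ => univ)
      (fun t _ => (field_lip F K hF).lipschitzOnWith) (t₀ := 0) (by simp [hn])
      (fun t ht => ⟨hZ n hn t ht, trivial⟩)
      (fun t ht => ⟨hZ m (hn.trans_le hm) t ⟨by linarith [ht.1], by linarith [ht.2]⟩, trivial⟩)
      (by rw [hZ0, hZ0])
  refine ⟨fun t => Z (|t| + 1) t, hZ0 _, fun t => ?_⟩
  have key : (fun s => Z (|s| + 1) s) =ᶠ[nhds t] Z (|t| + 2) := by
    filter_upwards [Metric.ball_mem_nhds t one_pos] with s hs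
    rw [Metric.mem_ball, Real.dist_eq] at hs
    have : |s| ≤ |t| + 1 := by
      have := abs_sub_abs_le_abs_sub s t
      linarith
    exact huniq _ _ (by positivity) (by linarith) (abs_lt.mp (by linarith))
  have ht := key.self_of_nhds
  have := hZ (|t| + 2) (by positivity) t (abs_lt.mp (by linarith))
  simp only at ht
  rw [← ht] at this
  exact this.congr_of_eventuallyEq key

/-- The global flow of the second-order equation with initial value `a` and zero initial slope. -/
structure ShootFlow (F : ℝ → ℝ) (y v : ℝ → ℝ → ℝ) : Prop where
  y0 : ∀ a, y a 0 = a
  v0 : ∀ a, v a 0 = 0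
  dy : ∀ a t, HasDerivAt (y a) (v a t) t
  dv : ∀ a t, HasDerivAt (v a) (F (y a t)) t
  even : ∀ a t, y a (-t) = y a t
  const : ∀ a, F a = 0 → ∀ t, y a t = a
  cont : Continuous (fun p : ℝ × ℝ => y p.1 p.2)

lemma flow_all (F : ℝ → ℝ) (K : NNReal) (hF : LipschitzWith K F) (M : ℝ) (hM : 0 ≤ M)
    (hFM : ∀ x, |F x| ≤ M) : ∃ y v, ShootFlow F y v := by
  choose z hz0 hz using flow_exists F K hF M hM hFM
  have hdy : ∀ a t, HasDerivAt (fun t => (z a t).1) (z a t).2 t := fun a t => hasDerivAt_fst' (hz a t)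
  have hdv : ∀ a t, HasDerivAt (fun t => (z a t).2) (F (z a t).1) t := fun a t => hasDerivAt_snd' (hz a t)
  have huniq : ∀ w : ℝ → ℝ × ℝ, ∀ a, w 0 = (a, 0) →
      (∀ t, HasDerivAt w ((w t).2, F (w t).1) t) → w = z a := by
    intro w a h0 hw
    exact ODE_solution_unique_univ (v := fun _ z => (z.2, F z.1)) (s := fun _ => univ) (t₀ := 0)
      (fun t => (field_lip F K hF).lipschitzOnWith) (fun t => ⟨hw t, trivial⟩)
      (fun t => ⟨hz a t, trivial⟩) (by rw [h0, hz0])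
  have heven : ∀ a t, (z a (-t)).1 = (z a t).1 := by
    intro a t
    have := huniq (fun t => ((z a (-t)).1, -(z a (-t)).2)) a (by simp [hz0]) ?_
    · exact (congrArg Prod.fst (congrFun this t) :)
    · intro t
      have h1 := (hdy a (-t)).comp t (hasDerivAt_neg t)
      have h2 := ((hdv a (-t)).comp t (hasDerivAt_neg t)).neg
      have := h1.prodMk h2
      convert this using 2 <;> simp
  have hbd : ∀ a b t, 0 ≤ t → dist (z a t) (z b t) ≤ |a - b| * exp ((max 1 K : NNReal) * t) := by
    intro a b t ht
    have := dist_le_of_trajectories_ODE (v := fun _ z => (z.2, F z.1)) (a := 0) (b := t)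
      (f := z a) (g := z b) (δ := |a - b|)
      (fun _ => field_lip F K hF) (fun s _ => (hz a s).continuousAt.continuousWithinAt)
      (fun s _ => (hz a s).hasDerivWithinAt) (fun s _ => (hz b s).continuousAt.continuousWithinAt)
      (fun s _ => (hz b s).hasDerivWithinAt) (by rw [hz0, hz0]; simp [Prod.dist_eq, Real.dist_eq])
      t ⟨ht, le_rfl⟩
    simpa using this
  refine ⟨fun a t => (z a t).1, fun a t => (z a t).2, ?_, ?_, hdy, hdv, heven, ?_, ?_⟩
  · intro a; simp [hz0]
  · intro a; simp [hz0]
  · intro a ha t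
    have := huniq (fun _ => (a, 0)) a rfl (fun t => by
      have := hasDerivAt_const t (a, (0:ℝ))
      simp only [ha]
      exact this)
    simp [← this]
  · rw [continuous_iff_continuousAt]
    rintro ⟨a, t⟩
    let C : NNReal := ⟨exp ((max 1 K : NNReal) * (|t| + 1)), (exp_pos _).le⟩
    have := continuousOn_prod_of_continuousOn_lipschitzOnWith
      (fun p : ℝ × ℝ => (z p.1 p.2).1) (s := univ) (t := Ioo (t - 1) (t + 1)) C
      (fun a _ s _ => (hdy a s).continuousAt.continuousWithinAt) ?_
    · exact this.continuousAt (prod_mem_nhds univ_mem (Ioo_mem_nhds (by linarith) (by linarith)))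
    · intro s hs
      apply LipschitzOnWith.of_dist_le_mul
      intro a _ b _
      have hs' : |s| ≤ |t| + 1 := by
        have h1 := abs_sub_abs_le_abs_sub s t
        have h2 : |s - t| ≤ 1 := abs_le.mpr ⟨by linarith [hs.1], by linarith [hs.2]⟩
        linarith
      have e : ∀ a, (z a s).1 = (z a |s|).1 := by
        intro a
        rcases abs_choice s with h | h <;> rw [h]
        rw [heven]
      simp only
      rw [e a, e b]
      have h1 := hbd a b |s| (abs_nonneg s)
      have h2 : dist (z a |s|).1 (z b |s|).1 ≤ dist (z a |s|) (z b |s|) := by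
        rw [Prod.dist_eq]; exact le_max_left _ _
      refine h2.trans (h1.trans ?_)
      rw [mul_comm, Real.dist_eq]
      apply mul_le_mul_of_nonneg_right _ (abs_nonneg _)
      change _ ≤ exp ((max 1 K : NNReal) * (|t| + 1))
      apply exp_le_exp.mpr
      gcongr

section shooting
variable {F : ℝ → ℝ} {y v : ℝ → ℝ → ℝ}

lemma ShootFlow.v_mono (h : ShootFlow F y v) (h0 : ∀ x, 0 ≤ F x) (a : ℝ) : Monotone (v a) := by
  apply monotone_of_deriv_nonneg (fun t => (h.dv a t).differentiableAt)
  intro t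
  rw [(h.dv a t).deriv]
  exact h0 _

lemma ShootFlow.v_pos (h : ShootFlow F y v) (hF : Continuous F) (h0 : ∀ x, 0 ≤ F x) {a : ℝ}
    (ha : 0 < F a) {t : ℝ} (ht : 0 < t) : 0 < v a t := by
  have hc : Continuous (fun s => F (y a s)) :=
    hF.comp (continuous_iff_continuousAt.mpr fun s => (h.dy a s).continuousAt)
  have hev : ∀ᶠ s in nhds 0, 0 < F (y a s) := by
    apply hc.continuousAt.eventually (lt_mem_nhds _)
    simp only [h.y0]; exact ha
  obtain ⟨δ, hδ, hb⟩ := Metric.eventually_nhds_iff.mp hev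
  have hm : 0 < min t (δ / 2) := lt_min ht (by linarith)
  have hs : StrictMonoOn (v a) (Icc 0 (min t (δ / 2))) := by
    apply strictMonoOn_of_deriv_pos (convex_Icc _ _)
      (fun s _ => (h.dv a s).continuousAt.continuousWithinAt)
    intro s hs
    rw [interior_Icc] at hs
    rw [(h.dv a s).deriv]
    apply hb
    rw [Real.dist_eq, sub_zero, abs_of_pos hs.1]
    have := min_le_right t (δ / 2)
    linarith [hs.2]
  have := hs ⟨le_rfl, hm.le⟩ ⟨hm.le, le_rfl⟩ hm
  rw [h.v0] at this
  exact this.trans_le (h.v_mono h0 a (min_le_left _ _))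

lemma ShootFlow.y_strictMono (h : ShootFlow F y v) (hF : Continuous F) (h0 : ∀ x, 0 ≤ F x) {a : ℝ}
    (ha : 0 < F a) : StrictMonoOn (y a) (Ici 0) := by
  apply strictMonoOn_of_deriv_pos (convex_Ici _)
    (fun s _ => (h.dy a s).continuousAt.continuousWithinAt)
  intro s hs
  rw [interior_Ici] at hs
  rw [(h.dy a s).deriv]
  exact h.v_pos hF h0 ha hs

lemma ShootFlow.exists_T (h : ShootFlow F y v) (hF : Continuous F) (h0 : ∀ x, 0 ≤ F x) {a p : ℝ}
    (ha : 0 < F a) (hp : a < p) : ∃ T, 0 < T ∧ y a T = p := by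
  have hv1 := h.v_pos hF h0 ha one_pos
  have hmono : MonotoneOn (fun t => y a t - v a 1 * t) (Ici 1) := by
    have hd : ∀ t, HasDerivAt (fun t => y a t - v a 1 * t) (v a t - v a 1 * 1) t := fun t =>
      (h.dy a t).sub ((hasDerivAt_id t).const_mul _)
    apply monotoneOn_of_deriv_nonneg (convex_Ici _)
      (fun s _ => (hd s).continuousAt.continuousWithinAt)
      (fun s _ => (hd s).differentiableAt.differentiableWithinAt)
    intro s hs
    rw [interior_Ici] at hs
    rw [(hd s).deriv]
    have := h.v_mono h0 a (le_of_lt hs)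
    linarith
  set R := max 1 ((p - y a 1 + v a 1) / v a 1) with hR
  have hR1 : 1 ≤ R := le_max_left _ _
  have hyR : p ≤ y a R := by
    have h1 := hmono (mem_Ici.mpr le_rfl) (mem_Ici.mpr hR1) hR1
    have h2 : (p - y a 1 + v a 1) / v a 1 ≤ R := le_max_right _ _
    rw [div_le_iff₀ hv1] at h2
    simp only at h1
    linarith
  obtain ⟨T, hT, hTp⟩ := intermediate_value_Icc (f := y a) (a := 0) (b := R) (by linarith)
    (fun s _ => (h.dy a s).continuousAt.continuousWithinAt) ⟨by rw [h.y0]; exact hp.le, hyR⟩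
  refine ⟨T, lt_of_le_of_ne hT.1 ?_, hTp⟩
  rintro rfl
  rw [h.y0] at hTp
  linarith

lemma ShootFlow.lt_T (h : ShootFlow F y v) (hF : Continuous F) (h0 : ∀ x, 0 ≤ F x) {a p T t : ℝ}
    (ha : 0 < F a) (hT : 0 < T) (hy : y a T = p) (ht : y a t < p) : t < T := by
  by_contra hcon
  push Not at hcon
  have := (h.y_strictMono hF h0 ha).monotoneOn (mem_Ici.mpr hT.le)
    (mem_Ici.mpr (hT.le.trans hcon)) hcon
  linarith

lemma ShootFlow.T_lt (h : ShootFlow F y v) (hF : Continuous F) (h0 : ∀ x, 0 ≤ F x) {a p T t : ℝ}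
    (ha : 0 < F a) (ht0 : 0 ≤ t) (hy : y a T = p) (ht : p < y a t) : T < t := by
  by_contra hcon
  push Not at hcon
  have := (h.y_strictMono hF h0 ha).monotoneOn (mem_Ici.mpr ht0)
    (mem_Ici.mpr (ht0.trans hcon)) hcon
  linarith

lemma ShootFlow.T_cont (h : ShootFlow F y v) (hF : Continuous F) (h0 : ∀ x, 0 ≤ F x) {p : ℝ}
    {J : Set ℝ} (hJ : ∀ a ∈ J, 0 < F a) (T : ℝ → ℝ) (hT : ∀ a ∈ J, 0 < T a ∧ y a (T a) = p) :
    ContinuousOn T J := by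
  intro a0 ha0
  have hca : ∀ t, Continuous (fun a => y a t) := fun t =>
    h.cont.comp (continuous_id.prodMk continuous_const)
  have hmono := h.y_strictMono hF h0 (hJ a0 ha0)
  obtain ⟨hT0, hy0⟩ := hT a0 ha0
  apply tendsto_order.mpr
  constructor
  · intro l hl
    rcases lt_or_ge l 0 with hl0 | hl0
    · filter_upwards [self_mem_nhdsWithin] with a ha using hl0.trans (hT a ha).1
    · have h1 : y a0 l < p := by
        rw [← hy0]; exact hmono (mem_Ici.mpr hl0) (mem_Ici.mpr hT0.le) hl
      have h2 : ∀ᶠ a in nhds a0, y a l < p := (hca l).continuousAt.eventually (gt_mem_nhds h1)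
      filter_upwards [self_mem_nhdsWithin, mem_nhdsWithin_of_mem_nhds h2] with a ha ha'
      exact h.lt_T hF h0 (hJ a ha) (hT a ha).1 (hT a ha).2 ha'
  · intro r hr
    have h1 : p < y a0 r := by
      rw [← hy0]; exact hmono (mem_Ici.mpr hT0.le) (mem_Ici.mpr (hT0.le.trans hr.le)) hr
    have h2 : ∀ᶠ a in nhds a0, p < y a r := (hca r).continuousAt.eventually (lt_mem_nhds h1)
    filter_upwards [self_mem_nhdsWithin, mem_nhdsWithin_of_mem_nhds h2] with a ha ha'
    exact h.T_lt hF h0 (hJ a ha) (hT0.le.trans hr.le) (hT a ha).2 ha'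

lemma ShootFlow.side (h : ShootFlow F y v) (hF : Continuous F) (h0 : ∀ x, 0 ≤ F x) {p z m : ℝ}
    (hz : F z = 0) (hzp : z < p) {q : ℝ → ℝ} (hq : Continuous q) (hm : 0 < m) (hqm : ∀ x, m ≤ q x)
    {J : Set ℝ} (hJ : ∀ a ∈ J, 0 < F a) (hJp : ∀ a ∈ J, a < p) (hJc : IsPreconnected J)
    (hne : J.Nonempty) (hJz : z ∈ closure J) :
    ∃ U0 : ℝ, 0 < U0 ∧ ∀ ub, U0 < ub → ∃ a ∈ J, ∃ T, 0 < T ∧ y a T = p ∧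
      4 * T ^ 2 * ∫ s in (0:ℝ)..1, q (y a (T * (2 * s - 1))) = ub := by
  have H : ∀ a, ∃ T, a ∈ J → 0 < T ∧ y a T = p := by
    intro a
    by_cases ha : a ∈ J
    · obtain ⟨T, hT⟩ := h.exists_T hF h0 (hJ a ha) (hJp a ha)
      exact ⟨T, fun _ => hT⟩
    · exact ⟨0, fun h => absurd h ha⟩
  choose T hT using H
  have hTc := h.T_cont hF h0 hJ T hT
  set U : ℝ → ℝ := fun a => 4 * (T a) ^ 2 * ∫ s in (0:ℝ)..1, q (y a (T a * (2 * s - 1))) with hU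
  have hUc : ContinuousOn U J := by
    rw [continuousOn_iff_continuous_domRestrict] at hTc ⊢
    have hc : Continuous (fun x : J × ℝ => q (y x.1 (T x.1 * (2 * x.2 - 1)))) := by
      apply hq.comp
      apply h.cont.comp (f := fun x : J × ℝ => ((x.1 : ℝ), T x.1 * (2 * x.2 - 1)))
      have : Continuous (fun x : J × ℝ => T x.1) := hTc.comp continuous_fst
      exact (continuous_subtype_val.comp continuous_fst).prodMk
        (this.mul ((continuous_const.mul continuous_snd).sub continuous_const))
    have hi := intervalIntegral.continuous_parametric_intervalIntegral_of_continuous'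
      (μ := volume) (f := fun (a : J) s => q (y a (T a * (2 * s - 1)))) hc 0 1
    have hT' : Continuous (fun a : J => T a) := hTc
    exact (continuous_const.mul (hT'.pow 2)).mul hi
  have hUlow : ∀ a, 4 * (T a) ^ 2 * m ≤ U a := by
    intro a
    have hc : Continuous (fun s : ℝ => q (y a (T a * (2 * s - 1)))) := by
      apply hq.comp
      exact h.cont.comp (f := fun s : ℝ => (a, T a * (2 * s - 1))) (by fun_prop)
    have : ∫ s in (0:ℝ)..1, m ≤ ∫ s in (0:ℝ)..1, q (y a (T a * (2 * s - 1))) :=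
      intervalIntegral.integral_mono_on zero_le_one (by simp) (hc.intervalIntegrable _ _)
        (fun s _ => hqm _)
    simp at this
    simp only [hU]
    exact mul_le_mul_of_nonneg_left this (by positivity)
  obtain ⟨b, hb⟩ := hne
  have hUb : 0 < U b := by
    have := (hT b hb).1
    exact lt_of_lt_of_le (by positivity) (hUlow b)
  refine ⟨U b, hUb, fun ub hub => ?_⟩
  set N := ub / (4 * m) + 1 with hN
  have hubp : 0 < ub := hUb.trans hub
  have hN1 : 1 ≤ N := by rw [hN]; have : 0 < ub / (4 * m) := by positivity
                         linarith
  have hNub : ub ≤ 4 * N ^ 2 * m := by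
    have h1 : ub = (N - 1) * (4 * m) := by rw [hN]; field_simp; ring
    have h2 : N - 1 ≤ N ^ 2 := by nlinarith
    rw [h1]; nlinarith
  have hca : Continuous (fun a => y a N) := h.cont.comp (continuous_id.prodMk continuous_const)
  have hev : ∀ᶠ a in nhds z, y a N < p :=
    hca.continuousAt.eventually (gt_mem_nhds (by simp only [h.const z hz]; exact hzp))
  obtain ⟨a', ha'p, ha'⟩ := mem_closure_iff_nhds.mp hJz _ hev
  have hTa : N < T a' := h.lt_T hF h0 (hJ a' ha') (hT a' ha').1 (hT a' ha').2 ha'p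
  have hUa : ub ≤ U a' := by
    refine (hNub.trans ?_).trans (hUlow a')
    gcongr
  obtain ⟨a, ha, hUe⟩ := hJc.intermediate_value hb ha' hUc ⟨hub.le, hUa⟩
  exact ⟨a, ha, T a, (hT a ha).1, (hT a ha).2, hUe⟩

end shooting

lemma contDiff_one_of {f f' : ℝ → ℝ} (h : ∀ x, HasDerivAt f (f' x) x) (hf' : Continuous f') :
    ContDiff ℝ 1 f := by
  rw [contDiff_one_iff_deriv]
  refine ⟨fun x => (h x).differentiableAt, ?_⟩
  rwa [show deriv f = f' from funext fun x => (h x).deriv]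

lemma contDiff_two_of {f f' : ℝ → ℝ} (h : ∀ x, HasDerivAt f (f' x) x) (hf' : ContDiff ℝ 1 f') :
    ContDiff ℝ 2 f := by
  rw [show (2 : WithTop ℕ∞) = 1 + 1 by norm_num, contDiff_succ_iff_deriv]
  refine ⟨fun x => (h x).differentiableAt, fun h => by simp at h, ?_⟩
  rwa [show deriv f = f' from funext fun x => (h x).deriv]

lemma periodic_bdd {f : ℝ → ℝ} {P : ℝ} (hP : 0 < P) (hf : Continuous f)
    (hp : Function.Periodic f P) : ∃ M : ℝ, 0 ≤ M ∧ ∀ x, |f x| ≤ M := by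
  obtain ⟨M, hM⟩ := (isCompact_Icc (a := (0:ℝ)) (b := P)).exists_bound_of_continuousOn
    hf.continuousOn
  have hb : ∀ x, |f x| ≤ M := by
    intro x
    obtain ⟨y, hy, hxy⟩ := hp.exists_mem_Ico₀ hP x
    rw [hxy]
    exact hM y ⟨hy.1, hy.2.le⟩
  exact ⟨M, (abs_nonneg _).trans (hb 0), hb⟩

lemma periodic_deriv {f : ℝ → ℝ} {P : ℝ} (hp : Function.Periodic f P) :
    Function.Periodic (deriv f) P := by
  intro x
  rw [← deriv_comp_add_const]
  congr 1
  exact funext hp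

lemma exists_inverse (c : ℝ → ℝ) (hc : Continuous c) (m : ℝ) (hm : 0 < m) (hcm : ∀ x, m ≤ c x) :
    ∃ Φ Ψ : ℝ → ℝ, StrictMono Φ ∧ StrictMono Ψ ∧ (∀ x, Φ (Ψ x) = x) ∧ (∀ x, Ψ (Φ x) = x) ∧
      ∀ x, HasDerivAt Ψ (c (Ψ x))⁻¹ x := by
  set Φ : ℝ → ℝ := fun x => ∫ s in (0:ℝ)..x, c s with hΦ
  have hd : ∀ x, HasDerivAt Φ (c x) x := fun x =>
    intervalIntegral.integral_hasDerivAt_right (hc.intervalIntegrable _ _)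
      (hc.stronglyMeasurableAtFilter _ _) hc.continuousAt
  have hmono : StrictMono Φ := by
    apply strictMono_of_deriv_pos
    intro x
    rw [(hd x).deriv]
    exact hm.trans_le (hcm x)
  have hcont : Continuous Φ := continuous_iff_continuousAt.mpr fun x => (hd x).continuousAt
  have hmono2 : Monotone (fun x => Φ x - m * x) := by
    have hd2 : ∀ x, HasDerivAt (fun x => Φ x - m * x) (c x - m * 1) x := fun x =>
      (hd x).sub ((hasDerivAt_id x).const_mul m)
    apply monotone_of_deriv_nonneg (fun x => (hd2 x).differentiableAt)
    intro x
    rw [(hd2 x).deriv]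
    linarith [hcm x]
  have hΦ0 : Φ 0 = 0 := by simp [hΦ]
  have hsurj : Function.Surjective Φ := by
    apply hcont.surjective
    · apply tendsto_atTop_mono' _ _ (tendsto_id.const_mul_atTop hm)
      filter_upwards [eventually_ge_atTop 0] with x hx
      have := hmono2 hx
      simp only [hΦ0] at this
      simp only [id]; linarith
    · apply tendsto_atBot_mono' _ _ (tendsto_id.const_mul_atBot hm)
      filter_upwards [eventually_le_atBot 0] with x hx
      have := hmono2 hx
      simp only [hΦ0] at this
      simp only [id]; linarith
  let e := hmono.orderIsoOfSurjective Φ hsurj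
  have he : ∀ x, Φ (e.symm x) = x := fun x => e.apply_symm_apply x
  refine ⟨Φ, e.symm, hmono, e.symm.strictMono, he, fun x => e.symm_apply_apply x, fun x => ?_⟩
  exact HasDerivAt.of_local_left_inverse e.symm.continuous.continuousAt (hd _)
    (hm.trans_le (hcm _)).ne' (Filter.Eventually.of_forall he)

lemma build_solution (g h c : ℝ → ℝ) (hg : ContDiff ℝ 2 g)
    (hc : ContDiff ℝ 2 c) (hg0 : ∀ x, 0 < g x) (hc0 : ∀ x, 0 < c x)
    {Ψ : ℝ → ℝ} (hΨ : ∀ x, HasDerivAt Ψ (c (Ψ x))⁻¹ x) {F : ℝ → ℝ} (hFc : Continuous F)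
    (hF : ∀ x, F x = h (Ψ x) / (g (Ψ x) * c (Ψ x))) {y v : ℝ → ℝ → ℝ} (fl : ShootFlow F y v)
    {a T p ub : ℝ} (hy : y a T = p)
    (hub : 4 * T ^ 2 * ∫ s in (0:ℝ)..1, (fun x => (g (Ψ x))⁻¹) (y a (T * (2 * s - 1))) = ub) :
    ∃ u, IsStationarySolution g h c (Ψ p) ub u (fun x => Ψ (y a (T * (2 * x - 1)))) := by
  have hΨc : Continuous Ψ := continuous_iff_continuousAt.mpr fun x => (hΨ x).continuousAt
  have hΨ1 : ContDiff ℝ 1 Ψ :=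
    contDiff_one_of hΨ ((hc.continuous.comp hΨc).inv₀ fun x => (hc0 _).ne')
  have hΨ2 : ContDiff ℝ 2 Ψ :=
    contDiff_two_of hΨ (((hc.of_le (by norm_num)).comp hΨ1).inv fun x => (hc0 _).ne')
  have hv1 : ContDiff ℝ 1 (v a) := contDiff_one_of (fl.dv a)
    (hFc.comp (continuous_iff_continuousAt.mpr fun s => (fl.dy a s).continuousAt))
  have hy2 : ContDiff ℝ 2 (y a) := contDiff_two_of (fl.dy a) hv1
  have hlin : ∀ x : ℝ, HasDerivAt (fun x : ℝ => T * (2 * x - 1)) (2 * T) x := by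
    intro x
    have := (((hasDerivAt_id x).const_mul 2).sub_const 1).const_mul T
    simpa [mul_comm] using this
  have hlin2 : ContDiff ℝ 2 (fun x : ℝ => T * (2 * x - 1)) := by fun_prop
  set th : ℝ → ℝ := fun x => Ψ (y a (T * (2 * x - 1))) with hth
  have hth2 : ContDiff ℝ 2 th := hΨ2.comp (hy2.comp hlin2)
  have hthd : ∀ x, HasDerivAt th ((c (th x))⁻¹ * (v a (T * (2 * x - 1)) * (2 * T))) x := fun x =>
    (hΨ _).comp x ((fl.dy a _).comp x (hlin x))
  have hk1 : ContDiff ℝ 1 (fun x => 4 * T ^ 2 * (g (th x))⁻¹) :=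
    contDiff_const.mul (((hg.comp hth2).of_le (by norm_num)).inv fun x => (hg0 _).ne')
  have hud : ∀ x, HasDerivAt (fun x => ∫ s in (0:ℝ)..x, 4 * T ^ 2 * (g (th s))⁻¹)
      (4 * T ^ 2 * (g (th x))⁻¹) x := fun x =>
    intervalIntegral.integral_hasDerivAt_right (hk1.continuous.intervalIntegrable _ _)
      (hk1.continuous.stronglyMeasurableAtFilter _ _) hk1.continuous.continuousAt
  refine ⟨fun x => ∫ s in (0:ℝ)..x, 4 * T ^ 2 * (g (th s))⁻¹, contDiff_two_of hud hk1, hth2,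
    ?_, ?_, by simp, ?_, ?_, ?_⟩
  · intro x _
    have : (fun y => g (th y) * deriv (fun x => ∫ s in (0:ℝ)..x, 4 * T ^ 2 * (g (th s))⁻¹) y)
        = fun _ => 4 * T ^ 2 := by
      funext w
      rw [(hud w).deriv]
      have := (hg0 (th w)).ne'
      field_simp
    rw [this]
    simp
  · intro x _
    have : (fun y => c (th y) * deriv th y) = fun x => v a (T * (2 * x - 1)) * (2 * T) := by
      funext w
      rw [(hthd w).deriv]
      have := (hc0 (th w)).ne'
      field_simp
    rw [this, (hud x).deriv]
    have h2 : HasDerivAt (fun x => v a (T * (2 * x - 1)) * (2 * T))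
        (F (y a (T * (2 * x - 1))) * (2 * T) * (2 * T)) x :=
      ((fl.dv a _).comp x (hlin x)).mul_const _
    rw [h2.deriv, hF]
    change c (th x) * (h (th x) / (g (th x) * c (th x)) * (2 * T) * (2 * T))
      - h (th x) * (4 * T ^ 2 * (g (th x))⁻¹) = 0
    have h3 := (hc0 (th x)).ne'
    have h4 := (hg0 (th x)).ne'
    field_simp
    ring
  · simp only [intervalIntegral.integral_const_mul]
    exact hub
  · simp only [hth]
    rw [show T * (2 * 0 - 1) = -T by ring, fl.even, hy]
  · simp only [hth]
    rw [show T * (2 * 1 - 1) = T by ring, hy]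

lemma main_abstract (g h c : ℝ → ℝ) (hg : ContDiff ℝ 2 g) (hh : ContDiff ℝ 2 h)
    (hc : ContDiff ℝ 2 c) (mg mc : ℝ) (hmg : 0 < mg) (hmc : 0 < mc)
    (hg0 : ∀ x, mg ≤ g x) (hc0 : ∀ x, mc ≤ c x) (hh0 : ∀ x, 0 ≤ h x)
    {P : ℝ} (hP : 0 < P) (hgP : Function.Periodic g P) (hhP : Function.Periodic h P)
    (hcP : Function.Periodic c P) {θs θ0 : ℝ} (hs0 : θs < θ0) (hs : h θs = 0)
    (hpos : ∀ x, x ≠ θs → |x - θs| < 1 → 0 < h x) :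
    ∃ ub0 : ℝ, 0 < ub0 ∧ ∀ ub : ℝ, ub0 < ub →
      ∃ u₁ th₁ u₂ th₂ : ℝ → ℝ,
        IsStationarySolution g h c θ0 ub u₁ th₁ ∧
        IsStationarySolution g h c θ0 ub u₂ th₂ ∧
        ¬(Set.EqOn u₁ u₂ (Set.Icc (0:ℝ) 1) ∧ Set.EqOn th₁ th₂ (Set.Icc (0:ℝ) 1)) := by
  have hgp : ∀ x, 0 < g x := fun x => hmg.trans_le (hg0 x)
  have hcp : ∀ x, 0 < c x := fun x => hmc.trans_le (hc0 x)
  obtain ⟨Φ, Ψ, hΦm, hΨm, hΦΨ, hΨΦ, hΨd⟩ := exists_inverse c hc.continuous mc hmc hc0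
  have hΨc : Continuous Ψ := continuous_iff_continuousAt.mpr fun x => (hΨd x).continuousAt
  set f : ℝ → ℝ := fun x => h x / (g x * c x) with hf
  have hf2 : ContDiff ℝ 2 f := hh.div (hg.mul hc) fun x => (mul_pos (hgp x) (hcp x)).ne'
  have hfP : Function.Periodic f P := by
    intro x; simp only [hf, hgP x, hhP x, hcP x]
  have hf0 : ∀ x, 0 ≤ f x := fun x => div_nonneg (hh0 x) (mul_pos (hgp x) (hcp x)).le
  set F : ℝ → ℝ := fun x => f (Ψ x) with hF
  have hFc : Continuous F := hf2.continuous.comp hΨc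
  have hFd : ∀ x, HasDerivAt F (deriv f (Ψ x) * (c (Ψ x))⁻¹) x := fun x =>
    ((hf2.differentiable (by norm_num)) (Ψ x)).hasDerivAt.comp x (hΨd x)
  obtain ⟨M, hM, hfM⟩ := periodic_bdd hP hf2.continuous hfP
  obtain ⟨L, hL, hfL⟩ := periodic_bdd (f := fun x => deriv f x * (c x)⁻¹) hP
    ((hf2.continuous_deriv (by norm_num)).mul (hc.continuous.inv₀ fun x => (hcp x).ne'))
    (by intro x; simp only [periodic_deriv hfP x, hcP x])
  have hLip : LipschitzWith ⟨L, hL⟩ F := by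
    apply lipschitzWith_of_nnnorm_deriv_le (fun x => (hFd x).differentiableAt)
    intro x
    rw [(hFd x).deriv]
    exact hfL (Ψ x)
  obtain ⟨y, v, fl⟩ := flow_all F _ hLip M hM (fun x => hfM _)
  obtain ⟨G, hG, hgG⟩ := periodic_bdd hP hg.continuous hgP
  have hGpos : 0 < G := (hgp 0).trans_le ((le_abs_self _).trans (hgG 0))
  have hq : Continuous (fun x => (g (Ψ x))⁻¹) :=
    (hg.continuous.comp hΨc).inv₀ fun x => (hgp _).ne'
  have hqm : ∀ x, G⁻¹ ≤ (fun x => (g (Ψ x))⁻¹) x := fun x =>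
    inv_anti₀ (hgp _) ((le_abs_self _).trans (hgG _))
  have hFz : F (Φ θs) = 0 := by simp [hF, hf, hΨΦ, hs]
  have hFpos : ∀ a, Ψ a ≠ θs → |Ψ a - θs| < 1 → 0 < F a := fun a h1 h2 =>
    div_pos (hpos _ h1 h2) (mul_pos (hgp _) (hcp _))
  have hlt : ∀ a b, a < Φ b → Ψ a < b := fun a b hab => by
    have := hΨm hab; rwa [hΨΦ] at this
  have hgt : ∀ a b, Φ b < a → b < Ψ a := fun a b hab => by
    have := hΨm hab; rwa [hΨΦ] at this
  have hb1 : Φ (θs - 1) < Φ θs := hΦm (by linarith)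
  have hb2 : Φ θs < Φ (min (θs + 1) θ0) := hΦm (lt_min (by linarith) hs0)
  obtain ⟨U1, hU1, H1⟩ := fl.side hFc (fun x => hf0 _) hFz (hΦm hs0) hq (inv_pos.mpr hGpos) hqm
    (J := Ioo (Φ (θs - 1)) (Φ θs))
    (fun a ha => by
      have h1 := hgt _ _ ha.1
      have h2 := hlt _ _ ha.2
      exact hFpos a h2.ne (abs_lt.mpr ⟨by linarith, by linarith⟩))
    (fun a ha => ha.2.trans (hΦm hs0)) isPreconnected_Ioo (nonempty_Ioo.mpr hb1)
    (by rw [closure_Ioo hb1.ne]; exact ⟨hb1.le, le_rfl⟩)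
  obtain ⟨U2, hU2, H2⟩ := fl.side hFc (fun x => hf0 _) hFz (hΦm hs0) hq (inv_pos.mpr hGpos) hqm
    (J := Ioo (Φ θs) (Φ (min (θs + 1) θ0)))
    (fun a ha => by
      have h1 := hgt _ _ ha.1
      have h2 := (hlt _ _ ha.2).trans_le (min_le_left _ _)
      exact hFpos a h1.ne' (abs_lt.mpr ⟨by linarith, by linarith⟩))
    (fun a ha => ha.2.trans_le (hΦm.monotone (min_le_right _ _))) isPreconnected_Ioo
    (nonempty_Ioo.mpr hb2)
    (by rw [closure_Ioo hb2.ne]; exact ⟨le_rfl, hb2.le⟩)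
  refine ⟨max U1 U2, lt_max_of_lt_left hU1, fun ub hub => ?_⟩
  obtain ⟨a1, ha1, T1, _, hy1, hi1⟩ := H1 ub ((le_max_left _ _).trans_lt hub)
  obtain ⟨a2, ha2, T2, _, hy2, hi2⟩ := H2 ub ((le_max_right _ _).trans_lt hub)
  obtain ⟨u1, hu1⟩ := build_solution g h c hg hc hgp hcp hΨd hFc (fun x => rfl) fl hy1 hi1
  obtain ⟨u2, hu2⟩ := build_solution g h c hg hc hgp hcp hΨd hFc (fun x => rfl) fl hy2 hi2
  rw [hΨΦ] at hu1 hu2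
  refine ⟨u1, _, u2, _, hu1, hu2, fun hcon => ?_⟩
  have := hcon.2 (show (1 / 2 : ℝ) ∈ Icc (0:ℝ) 1 by constructor <;> norm_num)
  simp only at this
  rw [show T1 * (2 * (1 / 2 : ℝ) - 1) = 0 by ring, show T2 * (2 * (1 / 2 : ℝ) - 1) = 0 by ring,
    fl.y0, fl.y0] at this
  have := hΨm.injective this
  linarith [ha1.2, ha2.1]

lemma sin_pos_near (n : ℤ) (x : ℝ) (hx : x ≠ n * π) (h1 : |x - n * π| < 1) :
    0 < Real.sin x ^ 2 := by
  have : Real.sin x ≠ 0 := by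
    intro h
    obtain ⟨m, hm⟩ := Real.sin_eq_zero_iff.mp h
    apply hx
    have hmn : m = n := by
      by_contra hne
      have h2 : (1:ℝ) ≤ |((m - n : ℤ) : ℝ)| := by
        exact_mod_cast Int.one_le_abs (sub_ne_zero.mpr hne)
      rw [← hm, ← sub_mul, abs_mul, abs_of_pos pi_pos] at h1
      push_cast at h2
      nlinarith [pi_gt_three]
    rw [← hm, hmn]
  positivity

theorem stmt_9
    (α1 α2 α3 α4 α5 α6 K1 K3 γ1 γ2 Cbar θ0 : ℝ)
    (hγ1 : γ1 = α3 - α2) (hγ2 : γ2 = α6 - α5) (hγ1pos : 0 < γ1)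
    (hK1 : 0 < K1) (hK3 : 0 < K3) (hCbar : 0 < Cbar)
    (g h c G : ℝ → ℝ)
    (hg : ∀ θ : ℝ, g θ = α1 * Real.sin θ ^ 2 * Real.cos θ ^ 2
        + (α5 - α2) / 2 * Real.sin θ ^ 2 + (α3 + α6) / 2 * Real.cos θ ^ 2 + α4 / 2)
    (hh : ∀ θ : ℝ, h θ = (γ1 + γ2 * Real.cos (2 * θ)) / 2)
    (hc : ∀ θ : ℝ, c θ = Real.sqrt (K1 * Real.cos θ ^ 2 + K3 * Real.sin θ ^ 2))
    (hdamp : ∀ θ : ℝ, Cbar ≤ g θ - h θ ^ 2 / γ1 ∧ g θ - h θ ^ 2 / γ1 ≤ g θ)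
    (hθ0 : h θ0 ≠ 0)
    (hG : ∀ θ : ℝ, G θ = ∫ s in θ0..θ, h s / g s)
    (hcase : γ2 = γ1 ∨ γ2 = -γ1)
    :
    ∃ ub0 : ℝ, 0 < ub0 ∧ ∀ ub : ℝ, ub0 < ub →
      ∃ u₁ th₁ u₂ th₂ : ℝ → ℝ,
        IsStationarySolution g h c θ0 ub u₁ th₁ ∧
        IsStationarySolution g h c θ0 ub u₂ th₂ ∧
        ¬(Set.EqOn u₁ u₂ (Set.Icc (0:ℝ) 1) ∧ Set.EqOn th₁ th₂ (Set.Icc (0:ℝ) 1)) := by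

  have hgf := funext hg
  have hhf := funext hh
  have hcf := funext hc
  have hposin : ∀ x : ℝ, 0 < K1 * Real.cos x ^ 2 + K3 * Real.sin x ^ 2 ∧
      min K1 K3 ≤ K1 * Real.cos x ^ 2 + K3 * Real.sin x ^ 2 := by
    intro x
    have hmin : 0 < min K1 K3 := lt_min hK1 hK3
    have hle : min K1 K3 ≤ K1 * Real.cos x ^ 2 + K3 * Real.sin x ^ 2 := by
      nlinarith [Real.sin_sq_add_cos_sq x, min_le_left K1 K3, min_le_right K1 K3,
        sq_nonneg (Real.sin x), sq_nonneg (Real.cos x)]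
    exact ⟨hmin.trans_le hle, hle⟩
  have hg2 : ContDiff ℝ 2 g := by rw [hgf]; fun_prop
  have hh2 : ContDiff ℝ 2 h := by rw [hhf]; fun_prop
  have hc2 : ContDiff ℝ 2 c := by
    rw [hcf]
    apply ContDiff.sqrt
    · fun_prop
    · intro x; exact (hposin x).1.ne'
  have hgP : Function.Periodic g (2 * π) := by
    intro x; rw [hg, hg, Real.sin_add_two_pi, Real.cos_add_two_pi]
  have hcP : Function.Periodic c (2 * π) := by
    intro x; rw [hc, hc, Real.sin_add_two_pi, Real.cos_add_two_pi]
  have hhP : Function.Periodic h (2 * π) := by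
    intro x
    rw [hh, hh, Real.cos_two_mul, Real.cos_two_mul, Real.cos_add_two_pi]
  have hcm : ∀ x, Real.sqrt (min K1 K3) ≤ c x := by
    intro x; rw [hc]; exact Real.sqrt_le_sqrt (hposin x).2
  have hgm : ∀ x, Cbar ≤ g x := fun x => (hdamp x).1.trans (hdamp x).2
  have hzero : ∃ θs, θs < θ0 ∧ h θs = 0 ∧ (∀ x, x ≠ θs → |x - θs| < 1 → 0 < h x) ∧
      ∀ x, 0 ≤ h x := by
    rcases hcase with hca | hca
    · have hsq : ∀ x, h x = γ1 * Real.sin (x + π / 2) ^ 2 := by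
        intro x
        rw [hh, hca, Real.cos_two_mul, Real.sin_add_pi_div_two]
        ring
      obtain ⟨n, hn⟩ := exists_int_lt ((θ0 + π / 2) / π)
      rw [lt_div_iff₀ pi_pos] at hn
      refine ⟨n * π - π / 2, by linarith, ?_, ?_, ?_⟩
      · rw [hsq, sub_add_cancel, Real.sin_int_mul_pi]; ring
      · intro x hx hx1
        rw [hsq]
        apply mul_pos hγ1pos
        apply sin_pos_near n
        · intro h; apply hx; linarith
        · convert hx1 using 2; ring
      · intro x; rw [hsq]; positivity
    · have hsq : ∀ x, h x = γ1 * Real.sin x ^ 2 := by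
        intro x
        rw [hh, hca, Real.cos_two_mul, Real.cos_sq']
        ring
      obtain ⟨n, hn⟩ := exists_int_lt (θ0 / π)
      rw [lt_div_iff₀ pi_pos] at hn
      refine ⟨n * π, hn, ?_, ?_, ?_⟩
      · rw [hsq, Real.sin_int_mul_pi]; ring
      · intro x hx hx1
        rw [hsq]
        exact mul_pos hγ1pos (sin_pos_near n x hx hx1)
      · intro x; rw [hsq]; positivity
  obtain ⟨θs, hs0, hs, hpos, hh0⟩ := hzero
  exact main_abstract g h c hg2 hh2 hc2 Cbar (Real.sqrt (min K1 K3)) hCbar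
    (Real.sqrt_pos.mpr (lt_min hK1 hK3)) hgm hcm hh0 two_pi_pos hgP hhP hcP hs0 hs hpos
end

section
/- Let e′ < e be two consecutive zeros of h with e < θ0 (so h > 0 on (e′, e)), and set βn := −G(e), βn+1 := −G(e′), and I := (βn, βn+1). Then D is continuous on I and attains a minimum value m := min_{β ∈ I} D(β) > 0. Moreover, for every ū with 0 < ū < 2m the equation 2D(β) = ū has no solution β ∈ I, while for every ū > 2m there exist at least two distinct β1, β2 ∈ I with 2D(β1) = ū and 2D(β2) = ū. -/
open Real Set Filter MeasureTheory


lemma aux_final {P : ℝ → ℝ} {a b : ℝ} (hab : a < b) (hP : ContinuousOn P (Ioo a b))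
    (hta : Tendsto P (nhdsWithin a (Ioo a b)) atTop) (htb : Tendsto P (nhdsWithin b (Ioo a b)) atTop) :
    ∃ x0 ∈ Ioo a b, (∀ x ∈ Ioo a b, P x0 ≤ P x) ∧
      ∀ u, P x0 < u → ∃ x1 ∈ Ioo a b, ∃ x2 ∈ Ioo a b, x1 < x2 ∧ P x1 = u ∧ P x2 = u := by
  rw [nhdsWithin_Ioo_eq_nhdsGT hab] at hta
  rw [nhdsWithin_Ioo_eq_nhdsLT hab] at htb
  -- points near the ends
  have hA : ∀ N y, y ∈ Ioo a b → ∃ a' ∈ Ioo a y, ∀ x ∈ Ioc a a', N ≤ P x := by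
    intro N y hy
    have h1 := hta.eventually_ge_atTop N
    rw [eventually_iff, mem_nhdsGT_iff_exists_Ioc_subset] at h1
    obtain ⟨c, hc, hs⟩ := h1
    have hc : a < c := hc
    refine ⟨min c ((a+y)/2), ⟨lt_min hc (by linarith [hy.1]), ?_⟩, ?_⟩
    · exact (min_le_right _ _).trans_lt (by linarith [hy.1])
    · exact fun x hx => hs ⟨hx.1, hx.2.trans (min_le_left _ _)⟩
  have hB : ∀ N y, y ∈ Ioo a b → ∃ b' ∈ Ioo y b, ∀ x ∈ Ico b' b, N ≤ P x := by
    intro N y hy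
    have h1 := htb.eventually_ge_atTop N
    rw [eventually_iff, mem_nhdsLT_iff_exists_Ico_subset] at h1
    obtain ⟨c, hc, hs⟩ := h1
    have hc : c < b := hc
    refine ⟨max c ((b+y)/2), ⟨?_, max_lt hc (by linarith [hy.2])⟩, ?_⟩
    · exact lt_of_lt_of_le (by linarith [hy.2]) (le_max_right _ _) 
    · exact fun x hx => hs ⟨(le_max_left _ _).trans hx.1, hx.2⟩
  have hm : (a+b)/2 ∈ Ioo a b := ⟨by linarith, by linarith⟩
  obtain ⟨a', ha', hPa⟩ := hA (P ((a+b)/2)) _ hm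
  obtain ⟨b', hb', hPb⟩ := hB (P ((a+b)/2)) _ hm
  have hsub : Icc a' b' ⊆ Ioo a b := fun x hx => ⟨ha'.1.trans_le hx.1, hx.2.trans_lt hb'.2⟩
  have hmm : (a+b)/2 ∈ Icc a' b' := ⟨ha'.2.le, hb'.1.le⟩
  obtain ⟨x0, hx0, hmin⟩ := isCompact_Icc.exists_isMinOn ⟨_, hmm⟩ (hP.mono hsub)
  have h0 := hsub hx0
  refine ⟨x0, h0, ?_, ?_⟩
  · intro x hx
    rcases le_total x a' with h | h
    · exact (hmin hmm).trans (hPa x ⟨hx.1, h⟩)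
    rcases le_total x b' with h' | h'
    · exact hmin ⟨h, h'⟩
    · exact (hmin hmm).trans (hPb x ⟨h', hx.2⟩)
  · intro u hu
    obtain ⟨p, hp, hPp⟩ := hA u x0 h0
    obtain ⟨q, hq, hPq⟩ := hB u x0 h0
    have s1 : Icc p x0 ⊆ Ioo a b := fun x hx => ⟨hp.1.trans_le hx.1, hx.2.trans_lt h0.2⟩
    have s2 : Icc x0 q ⊆ Ioo a b := fun x hx => ⟨h0.1.trans_le hx.1, hx.2.trans_lt hq.2⟩
    obtain ⟨x1, hx1, e1⟩ := intermediate_value_Icc' hp.2.le (hP.mono s1)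
      ⟨hu.le, hPp p ⟨hp.1, le_rfl⟩⟩
    obtain ⟨x2, hx2, e2⟩ := intermediate_value_Icc hq.1.le (hP.mono s2)
      ⟨hu.le, hPq q ⟨le_rfl, hq.2⟩⟩
    refine ⟨x1, s1 hx1, x2, s2 hx2, lt_of_le_of_ne (hx1.2.trans hx2.1) ?_, e1, e2⟩
    rintro rfl
    have : x1 = x0 := le_antisymm hx1.2 hx2.1
    rw [this] at e1
    linarith

lemma aux_lin {G p : ℝ → ℝ} (hp : Continuous p) (hGd : ∀ x, HasDerivAt G (p x) x)
    (hp0 : ∀ x, 0 ≤ p x) (ψ0 T : ℝ) (hT : ψ0 < T) (hpψ : 0 < p ψ0) :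
    ∃ ρ > 0, ∃ δ > 0, ∀ ψ, |ψ - ψ0| ≤ ρ → ∀ θ, ψ ≤ θ → θ ≤ T → δ * (θ - ψ) ≤ G θ - G ψ := by
  have hev : ∀ᶠ x in nhds ψ0, p ψ0 / 2 < p x :=
    hp.continuousAt.eventually_const_lt (by linarith)
  obtain ⟨r, hr, hball⟩ := Metric.eventually_nhds_iff.1 hev
  have hdiff : Differentiable ℝ G := fun x => (hGd x).differentiableAt
  have hmono : Monotone G := monotone_of_deriv_nonneg hdiff (fun x => by
    rw [(hGd x).deriv]; exact hp0 x)
  set ρ := r / 4 with hρ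
  have hρ0 : 0 < ρ := by positivity
  set η := p ψ0 / 2 with hη
  have hη0 : 0 < η := by positivity
  have key : ∀ ψ θ, |ψ - ψ0| ≤ ρ → ψ ≤ θ → θ ≤ ψ0 + 2 * ρ → η * (θ - ψ) ≤ G θ - G ψ := by
    intro ψ θ h1 h2 h3
    refine (convex_Icc ψ θ).mul_sub_le_image_sub_of_le_deriv hdiff.continuous.continuousOn
      hdiff.differentiableOn ?_ ψ ⟨le_rfl, h2⟩ θ ⟨h2, le_rfl⟩ h2
    intro x hx
    rw [interior_Icc] at hx
    rw [(hGd x).deriv]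
    refine (hball ?_).le
    rw [Real.dist_eq, abs_lt]
    have := abs_le.1 h1
    constructor <;> linarith [hx.1, hx.2]
  have hL : 0 < T - ψ0 + ρ := by linarith
  refine ⟨ρ, hρ0, min η (η * ρ / (T - ψ0 + ρ)), lt_min hη0 (by positivity), ?_⟩
  intro ψ h1 θ h2 h3
  have hψ := abs_le.1 h1
  rcases le_total θ (ψ0 + 2 * ρ) with h | h
  · exact (mul_le_mul_of_nonneg_right (min_le_left _ _) (by linarith)).trans (key ψ θ h1 h2 h)
  · have k1 := key ψ (ψ0 + 2 * ρ) h1 (by linarith) le_rfl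
    have k2 := hmono h
    calc _ ≤ (η * ρ / (T - ψ0 + ρ)) * (T - ψ0 + ρ) := by
            gcongr
            · exact min_le_right _ _
            · linarith
      _ = η * ρ := by field_simp
      _ ≤ η * (ψ0 + 2 * ρ - ψ) := by gcongr; linarith
      _ ≤ _ := by linarith

lemma aux_rsqrt (C a b : ℝ) : IntervalIntegrable (fun x => C / √x) volume a b := by
  have : (fun x : ℝ => C / √x) =ᵐ[volume] fun x => C * (x ^ (-(1/2) : ℝ) * (Ioi (0:ℝ)).indicator 1 x) := by
    refine Eventually.of_forall fun x => ?_
    rcases le_or_gt x 0 with h | h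
    · simp [Real.sqrt_eq_zero_of_nonpos h, not_lt.2 h]
    · simp only [mem_Ioi, h, indicator_of_mem, Pi.one_apply, mul_one]
      rw [Real.rpow_neg h.le, Real.sqrt_eq_rpow, div_eq_mul_inv]
  have h1 := (intervalIntegral.intervalIntegrable_rpow' (a := a) (b := b) (r := -(1/2)) (by norm_num))
  have h2 : IntervalIntegrable (fun x : ℝ => x ^ (-(1/2) : ℝ) * (Ioi (0:ℝ)).indicator 1 x) volume a b := by
    refine h1.mono_fun ?_ ?_
    · refine (Measurable.mul (by fun_prop) ?_).aestronglyMeasurable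
      exact measurable_one.indicator measurableSet_Ioi
    · refine Eventually.of_forall fun x => ?_
      by_cases h : x ∈ Ioi (0:ℝ) <;> simp [h]
  exact (h2.const_mul C).congr_ae (ae_restrict_of_ae this.symm)

noncomputable def auxPhi (G k : ℝ → ℝ) (T ψ : ℝ) : ℝ := ∫ θ in ψ..T, k θ / √(G θ - G ψ)

lemma aux_cont {G p k : ℝ → ℝ} (hp : Continuous p) (hGd : ∀ x, HasDerivAt G (p x) x)
    (hp0 : ∀ x, 0 ≤ p x) (hk : Continuous k) (K : ℝ) (hkK : ∀ x, |k x| ≤ K) (ψ0 T : ℝ)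
    (hT : ψ0 < T) (hpψ : 0 < p ψ0) : ContinuousAt (auxPhi G k T) ψ0 := by
  obtain ⟨ρ, hρ, δ, hδ, hlin⟩ := aux_lin hp hGd hp0 ψ0 T hT hpψ
  have hGc : Continuous G := continuous_iff_continuousAt.2 fun x => (hGd x).continuousAt
  have hK : 0 ≤ K := (abs_nonneg _).trans (hkK 0)
  have hrep : auxPhi G k T = fun ψ => (T - ψ) * ∫ x in (0:ℝ)..1,
      k (ψ + (T - ψ) * x) / √(G (ψ + (T - ψ) * x) - G ψ) := by
    funext ψ
    have := intervalIntegral.smul_integral_comp_add_mul (a := 0) (b := 1)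
      (fun θ => k θ / √(G θ - G ψ)) (T - ψ) ψ
    simp only [smul_eq_mul, mul_zero, mul_one, add_zero, add_sub_cancel] at this
    rw [this, auxPhi]
  rw [hrep]
  refine ContinuousAt.mul (by fun_prop) ?_
  have hev : ∀ᶠ ψ in nhds ψ0, |ψ - ψ0| ≤ ρ ∧ (T - ψ0)/2 < T - ψ := by
    refine Filter.Eventually.and ?_ ?_
    · filter_upwards [Metric.closedBall_mem_nhds ψ0 hρ] with x hx
      simpa [Real.dist_eq] using hx
    · exact (by fun_prop : ContinuousAt (fun ψ : ℝ => T - ψ) ψ0).eventually_const_lt (by linarith)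
  refine intervalIntegral.continuousAt_of_dominated_interval
    (bound := fun x => (K / √(δ * ((T - ψ0)/2))) / √x) ?_ ?_ (aux_rsqrt _ _ _) ?_
  · refine Eventually.of_forall fun ψ => Measurable.aestronglyMeasurable ?_
    exact Measurable.div (Continuous.measurable (by fun_prop)) (Continuous.measurable (by fun_prop))
  · filter_upwards [hev] with ψ hψ
    refine Eventually.of_forall fun x hx => ?_
    rw [uIoc_of_le zero_le_one] at hx
    have hd : 0 < T - ψ := by linarith
    have h1 := hlin ψ hψ.1 (ψ + (T - ψ) * x) (by nlinarith [hx.1]) (by nlinarith [hx.2])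
    have h2 : δ * ((T - ψ0)/2) * x ≤ G (ψ + (T - ψ) * x) - G ψ := by
      refine le_trans ?_ h1
      rw [add_sub_cancel_left, ← mul_assoc]
      gcongr
      · exact hx.1.le
      · exact hψ.2.le
    have h3 : 0 < δ * ((T - ψ0)/2) := by have : 0 < T - ψ0 := by linarith
                                         positivity
    rw [div_div, ← Real.sqrt_mul h3.le, norm_div, Real.norm_eq_abs, Real.norm_eq_abs,
      abs_of_nonneg (Real.sqrt_nonneg _)]
    have h4 : 0 < δ * ((T - ψ0)/2) * x := mul_pos h3 hx.1
    gcongr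
    exact hkK _
  · refine Eventually.of_forall fun x hx => ?_
    rw [uIoc_of_le zero_le_one] at hx
    refine ContinuousAt.div (by fun_prop) (by fun_prop) ?_
    have hd : 0 < T - ψ0 := by linarith
    have h1 := hlin ψ0 (by simpa using hρ.le) (ψ0 + (T - ψ0) * x) (by nlinarith [hx.1]) (by nlinarith [hx.2])
    rw [add_sub_cancel_left] at h1
    have := mul_pos hδ (mul_pos hd hx.1)
    exact (Real.sqrt_pos.2 (by linarith)).ne'

lemma aux_int {G p k : ℝ → ℝ} (hp : Continuous p) (hGd : ∀ x, HasDerivAt G (p x) x)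
    (hp0 : ∀ x, 0 ≤ p x) (hk : Continuous k) (K : ℝ) (hkK : ∀ x, |k x| ≤ K) (ψ0 T : ℝ)
    (hT : ψ0 < T) (hpψ : 0 < p ψ0) :
    IntervalIntegrable (fun θ => k θ / √(G θ - G ψ0)) volume ψ0 T := by
  obtain ⟨ρ, hρ, δ, hδ, hlin⟩ := aux_lin hp hGd hp0 ψ0 T hT hpψ
  have hGc : Continuous G := continuous_iff_continuousAt.2 fun x => (hGd x).continuousAt
  have hK : 0 ≤ K := (abs_nonneg _).trans (hkK 0)
  have h1 : IntervalIntegrable (fun θ => (K / √δ) / √(θ - ψ0)) volume ψ0 T := by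
    have := (aux_rsqrt (K / √δ) 0 (T - ψ0)).comp_sub_right ψ0
    simpa using this
  refine h1.mono_fun ?_ ?_
  · exact (Measurable.div (Continuous.measurable (by fun_prop)) (Continuous.measurable (by fun_prop))).aestronglyMeasurable
  · rw [uIoc_of_le hT.le]
    refine (ae_restrict_iff' measurableSet_Ioc).2 (Eventually.of_forall fun x hx => ?_)
    have h2 := hlin ψ0 (by simpa using hρ.le) x hx.1.le hx.2
    have h4 : 0 < δ * (x - ψ0) := mul_pos hδ (by linarith [hx.1])
    show ‖k x / √(G x - G ψ0)‖ ≤ ‖K / √δ / √(x - ψ0)‖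
    rw [div_div, ← Real.sqrt_mul hδ.le, norm_div, norm_div, Real.norm_eq_abs, Real.norm_eq_abs, Real.norm_eq_abs, Real.norm_eq_abs,
      abs_of_nonneg (Real.sqrt_nonneg _), abs_of_nonneg (Real.sqrt_nonneg _), abs_of_nonneg hK]
    gcongr
    exact hkK _

lemma aux_lower {G p k : ℝ → ℝ} (hp : Continuous p) (hGd : ∀ x, HasDerivAt G (p x) x)
    (hp0 : ∀ x, 0 ≤ p x) (hinj : Function.Injective G)
    (hk : Continuous k) (K k0 : ℝ) (hkK : ∀ x, |k x| ≤ K) (hk0 : 0 < k0) (hkk0 : ∀ x, k0 ≤ k x)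
    (ψ T : ℝ) (hpψ : 0 < p ψ)
    (M z ε : ℝ) (hM : 0 < M) (hz : ∀ x, p x ≤ M * (x - z)^2) (hε : 0 < ε) (hψz : |ψ - z| ≤ ε)
    (hεT : ψ + ε ≤ T) : ε * (k0 / √(4 * M * ε^3)) ≤ auxPhi G k T ψ := by
  have hT : ψ < T := by linarith
  have hdiff : Differentiable ℝ G := fun x => (hGd x).differentiableAt
  have hmono : StrictMono G := (monotone_of_deriv_nonneg hdiff (fun x => by
    rw [(hGd x).deriv]; exact hp0 x)).strictMono_of_injective hinj
  have hintg := aux_int hp hGd hp0 hk K hkK ψ T hT hpψ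
  have h1 : ∫ θ in ψ..(ψ+ε), k θ / √(G θ - G ψ) ≤ auxPhi G k T ψ := by
    refine intervalIntegral.integral_mono_interval le_rfl (by linarith) hεT ?_ hintg
    refine Eventually.of_forall fun x => ?_
    have := hkk0 x
    exact div_nonneg (by linarith) (Real.sqrt_nonneg _)
  refine le_trans ?_ h1
  have h2 : ∫ θ in ψ..(ψ+ε), k0 / √(4 * M * ε^3) = ε * (k0 / √(4 * M * ε^3)) := by
    simp [mul_div_assoc]
  rw [← h2]
  refine intervalIntegral.integral_mono_on_of_le_Ioo (by linarith) (by simp) ?_ ?_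
  · exact hintg.mono_set (by rw [uIcc_of_le (by linarith), uIcc_of_le hT.le]; exact Icc_subset_Icc le_rfl hεT)
  · intro x hx
    have h3 : 0 < G x - G ψ := sub_pos.2 (hmono hx.1)
    have h4 : G x - G ψ ≤ 4 * M * ε^3 := by
      have := (convex_Icc ψ x).image_sub_le_mul_sub_of_deriv_le (C := 4 * M * ε^2)
        hdiff.continuous.continuousOn hdiff.differentiableOn ?_ ψ ⟨le_rfl, hx.1.le⟩ x ⟨hx.1.le, le_rfl⟩ hx.1.le
      · refine this.trans ?_
        have : x - ψ ≤ ε := by linarith [hx.2]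
        calc _ ≤ 4 * M * ε^2 * ε := by gcongr
          _ = _ := by ring
      · intro y hy
        rw [interior_Icc] at hy
        rw [(hGd y).deriv]
        refine (hz y).trans ?_
        have : (y - z)^2 ≤ (2*ε)^2 := by
          have := abs_le.1 hψz
          apply sq_le_sq'
          · linarith [hy.1]
          · linarith [hy.2, hx.2]
        nlinarith
    gcongr
    · exact hk0.le.trans (hkk0 x)
    · exact hkk0 x

lemma aux_tend {G p k k' : ℝ → ℝ} (hp : Continuous p) (hGd : ∀ x, HasDerivAt G (p x) x)
    (hp0 : ∀ x, 0 ≤ p x) (hinj : Function.Injective G)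
    (hk : Continuous k) (K k0 : ℝ) (hkK : ∀ x, |k x| ≤ K) (hk0 : 0 < k0) (hkk0 : ∀ x, k0 ≤ k x)
    (hk' : Continuous k') (K' k0' : ℝ) (hkK' : ∀ x, |k' x| ≤ K') (hk0' : 0 < k0') (hkk0' : ∀ x, k0' ≤ k' x)
    (S : Set ℝ) (T : ℝ) (hpψ : ∀ x ∈ S, 0 < p x)
    (M z : ℝ) (hM : 0 < M) (hz : ∀ x, p x ≤ M * (x - z)^2) (hzS : z ∉ S) (hzT : z < T) :
    Tendsto (fun ψ => auxPhi G k T ψ * auxPhi G k' T ψ) (nhdsWithin z S) atTop := by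
  have ht : Tendsto (fun ψ => (k0 * k0' / (4 * M)) * (|ψ - z|)⁻¹) (nhdsWithin z S) atTop := by
    refine Tendsto.const_mul_atTop (by positivity) ?_
    refine tendsto_inv_nhdsGT_zero.comp ?_
    refine tendsto_nhdsWithin_iff.2 ⟨?_, ?_⟩
    · have : Tendsto (fun ψ : ℝ => |ψ - z|) (nhds z) (nhds |z - z|) :=
        (by fun_prop : Continuous fun ψ : ℝ => |ψ - z|).continuousAt
      rw [sub_self, abs_zero] at this
      exact this.mono_left nhdsWithin_le_nhds
    · filter_upwards [self_mem_nhdsWithin] with x hx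
      exact abs_pos.2 (sub_ne_zero.2 (ne_of_mem_of_not_mem hx hzS))
  refine tendsto_atTop_mono' _ ?_ ht
  have hev : ∀ᶠ ψ in nhds z, ψ + |ψ - z| < T :=
    (by fun_prop : ContinuousAt (fun ψ : ℝ => ψ + |ψ - z|) z).eventually_lt_const (by simpa using hzT)
  filter_upwards [self_mem_nhdsWithin, mem_nhdsWithin_of_mem_nhds hev] with x hx hxT
  have hε : 0 < |x - z| := abs_pos.2 (sub_ne_zero.2 (ne_of_mem_of_not_mem hx hzS))
  have hxT' : x + |x - z| < T := hxT
  have a1 := aux_lower hp hGd hp0 hinj hk K k0 hkK hk0 hkk0 x T (hpψ x hx) M z _ hM hz hε le_rfl hxT'.le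
  have a2 := aux_lower hp hGd hp0 hinj hk' K' k0' hkK' hk0' hkk0' x T (hpψ x hx) M z _ hM hz hε le_rfl hxT'.le
  refine le_trans (le_of_eq ?_) (mul_le_mul a1 a2 (by positivity) (le_trans (by positivity) a1))
  set ε := |x - z|
  have hq : √(4 * M * ε^3) * √(4 * M * ε^3) = 4 * M * ε^3 := Real.mul_self_sqrt (by positivity)
  have : ε * (k0 / √(4 * M * ε ^ 3)) * (ε * (k0' / √(4 * M * ε ^ 3))) =
    ε^2 * (k0 * k0') / (√(4 * M * ε^3) * √(4 * M * ε^3)) := by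
      field_simp
  rw [this, hq]
  field_simp

lemma aux_cov {G g h w F : ℝ → ℝ} (hg : ∀ x, 0 < g x)
    (hGd : ∀ x, HasDerivAt G (h x / g x) x)
    (hp0 : ∀ x, 0 ≤ h x / g x) (hnull : ∀ᵐ x, h x ≠ 0)
    (hF : Function.LeftInverse F G) (ψ T : ℝ) (hT : ψ < T) (hGT : G T = 0) :
    ∫ t in (0:ℝ)..(-G ψ), w (F (t - -G ψ)) / h (F (t - -G ψ)) / √t
      = auxPhi G (fun x => w x / g x) T ψ := by
  have hdiff : Differentiable ℝ G := fun x => (hGd x).differentiableAt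
  have hmono : StrictMono G := (monotone_of_deriv_nonneg hdiff (fun x => by
    rw [(hGd x).deriv]; exact hp0 x)).strictMono_of_injective hF.injective
  have h1 := intervalIntegral.integral_comp_sub_right (a := 0) (b := -G ψ)
    (fun s => w (F s) / h (F s) / √(s + -G ψ)) (-G ψ)
  simp only [sub_add_cancel, zero_sub, neg_neg, sub_self] at h1
  rw [h1, intervalIntegral.integral_of_le (by rw [← hGT]; exact (hmono hT).le), ← integral_Icc_eq_integral_Ioc]
  rw [← hGT, ← integral_Icc_deriv_smul_of_deriv_nonneg (f := G) (f' := fun x => h x / g x) hdiff.continuous.continuousOn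
    (fun x _ => hGd x) (fun x _ => hp0 x) hT.le]
  rw [auxPhi, intervalIntegral.integral_of_le hT.le, ← integral_Icc_eq_integral_Ioc]
  refine integral_congr_ae (ae_restrict_of_ae ?_)
  filter_upwards [hnull] with x hx
  have := hg x
  simp only [hF x, smul_eq_mul, ← sub_eq_add_neg]
  field_simp

/-- Between two consecutive zeros `e′ < e` of `h` with `e < θ0`,
setting `βn := −G(e)`, `βn+1 := −G(e′)`, `I := (βn, βn+1)`: `D` is continuous on `I`
and attains a positive minimum `m` there; for `0 < ū < 2m` the equation `2D(β) = ū`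
has no solution in `I`, while for `ū > 2m` it has at least two distinct solutions. -/
theorem stmt_10
    (α1 α2 α3 α4 α5 α6 K1 K3 γ1 γ2 Cbar θ0 : ℝ)
    (hγ1 : γ1 = α3 - α2) (hγ2 : γ2 = α6 - α5) (hγ1pos : 0 < γ1)
    (hK1 : 0 < K1) (hK3 : 0 < K3) (hCbar : 0 < Cbar)
    (g h c G : ℝ → ℝ)
    (hg : ∀ θ : ℝ, g θ = α1 * Real.sin θ ^ 2 * Real.cos θ ^ 2
        + (α5 - α2) / 2 * Real.sin θ ^ 2 + (α3 + α6) / 2 * Real.cos θ ^ 2 + α4 / 2)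
    (hh : ∀ θ : ℝ, h θ = (γ1 + γ2 * Real.cos (2 * θ)) / 2)
    (hc : ∀ θ : ℝ, c θ = Real.sqrt (K1 * Real.cos θ ^ 2 + K3 * Real.sin θ ^ 2))
    (hdamp : ∀ θ : ℝ, Cbar ≤ g θ - h θ ^ 2 / γ1 ∧ g θ - h θ ^ 2 / γ1 ≤ g θ)
    (hθ0 : h θ0 ≠ 0)
    (hG : ∀ θ : ℝ, G θ = ∫ s in θ0..θ, h s / g s)
    (hcase : γ2 = γ1 ∨ γ2 = -γ1)
    (F D : ℝ → ℝ)
    (hF : Function.LeftInverse F G) (hF' : Function.RightInverse F G)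
    (hD : ∀ β : ℝ, D β =
      (∫ t in (0:ℝ)..β, c (F (t - β)) * g (F (t - β)) / h (F (t - β)) / Real.sqrt t) *
      (∫ t in (0:ℝ)..β, c (F (t - β)) / h (F (t - β)) / Real.sqrt t))
    (e' e : ℝ) (he' : h e' = 0) (he : h e = 0) (he'e : e' < e)
    (hcons : ∀ z ∈ Set.Ioo e' e, h z ≠ 0) (heθ0 : e < θ0) :
    ContinuousOn D (Set.Ioo (-G e) (-G e')) ∧
    ∃ m : ℝ, 0 < m ∧
      (∃ β ∈ Set.Ioo (-G e) (-G e'), D β = m) ∧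
      (∀ β ∈ Set.Ioo (-G e) (-G e'), m ≤ D β) ∧
      (∀ ub : ℝ, 0 < ub → ub < 2 * m →
        ¬ ∃ β ∈ Set.Ioo (-G e) (-G e'), 2 * D β = ub) ∧
      (∀ ub : ℝ, 2 * m < ub →
        ∃ β₁ ∈ Set.Ioo (-G e) (-G e'), ∃ β₂ ∈ Set.Ioo (-G e) (-G e'),
          β₁ ≠ β₂ ∧ 2 * D β₁ = ub ∧ 2 * D β₂ = ub) := by
  have hgpos : ∀ x, 0 < g x := fun x => hCbar.trans_le ((hdamp x).1.trans (hdamp x).2)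
  have hgC : ∀ x, Cbar ≤ g x := fun x => (hdamp x).1.trans (hdamp x).2
  have hgfun : g = fun θ => α1 * Real.sin θ ^ 2 * Real.cos θ ^ 2
        + (α5 - α2) / 2 * Real.sin θ ^ 2 + (α3 + α6) / 2 * Real.cos θ ^ 2 + α4 / 2 := funext hg
  have hgc : Continuous g := by rw [hgfun]; fun_prop
  have hhc : Continuous h := by rw [funext hh]; fun_prop
  have hcc : Continuous c := by rw [funext hc]; fun_prop
  have hpc : Continuous (fun x => h x / g x) := hhc.div hgc fun x => (hgpos x).ne'
  have hGd : ∀ x, HasDerivAt G (h x / g x) x := by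
    intro x
    rw [funext hG]
    exact intervalIntegral.integral_hasDerivAt_right (hpc.intervalIntegrable _ _)
      (hpc.stronglyMeasurableAtFilter _ _) hpc.continuousAt
  have hh0 : ∀ x, 0 ≤ h x := by
    intro x
    rw [hh]
    have h1 := Real.neg_one_le_cos (2 * x)
    have h2 := Real.cos_le_one (2 * x)
    rcases hcase with h | h <;> rw [h] <;> nlinarith
  have hp0 : ∀ x, 0 ≤ h x / g x := fun x => div_nonneg (hh0 x) (hgpos x).le
  have hquad : ∀ z, h z = 0 → ∀ x, h x ≤ γ1 * (x - z) ^ 2 := by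
    intro z hz x
    rw [hh] at hz ⊢
    have hx : 2 * x = 2 * z + 2 * (x - z) := by ring
    have hcz : γ2 * Real.cos (2 * z) = - γ1 := by linarith
    have hsz : Real.sin (2 * z) = 0 := by
      have h1 := Real.sin_sq_add_cos_sq (2 * z)
      have h2 : γ2 ^ 2 * Real.cos (2 * z) ^ 2 = γ1 ^ 2 := by rw [← mul_pow, hcz]; ring
      have h3 : γ2 ^ 2 = γ1 ^ 2 := by rcases hcase with h | h <;> rw [h]; ring
      rw [h3] at h2
      have h4 : Real.cos (2 * z) ^ 2 = 1 := by
        have : γ1 ^ 2 ≠ 0 := by positivity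
        exact mul_left_cancel₀ this (by linarith)
      have : Real.sin (2 * z) ^ 2 = 0 := by linarith
      exact pow_eq_zero_iff (two_ne_zero) |>.1 this
    rw [hx, Real.cos_add, hsz, zero_mul, sub_zero, ← mul_assoc, hcz]
    have := Real.one_sub_sq_div_two_le_cos (x := 2 * (x - z))
    nlinarith
  have hM : 0 < γ1 / Cbar := by positivity
  have hpquad : ∀ z, h z = 0 → ∀ x, h x / g x ≤ γ1 / Cbar * (x - z) ^ 2 := by
    intro z hz x
    calc h x / g x ≤ (γ1 * (x - z) ^ 2) / Cbar := by
          gcongr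
          · exact hquad z hz x
          · exact hgC x
      _ = _ := by ring
  have hnull : ∀ᵐ x, h x ≠ 0 := by
    have hcount : {x | h x = 0}.Countable := by
      rcases hcase with hγ | hγ
      · refine (countable_range (fun n : ℤ => (2 * (n:ℝ) + 1) * π / 2)).mono ?_
        intro x hx
        have hx : h x = 0 := hx
        rw [hh, hγ, Real.cos_two_mul] at hx
        have : Real.cos x = 0 := by
          have : γ1 * Real.cos x ^ 2 = 0 := by linarith
          simpa [hγ1pos.ne'] using this
        obtain ⟨n, hn⟩ := Real.cos_eq_zero_iff.1 this
        exact ⟨n, hn.symm⟩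
      · refine (countable_range (fun n : ℤ => (n:ℝ) * π)).mono ?_
        intro x hx
        have hx : h x = 0 := hx
        rw [hh, hγ, Real.cos_two_mul, Real.cos_sq'] at hx
        have : Real.sin x = 0 := by
          have : γ1 * Real.sin x ^ 2 = 0 := by linarith
          simpa [hγ1pos.ne'] using this
        obtain ⟨n, hn⟩ := Real.sin_eq_zero_iff.1 this
        exact ⟨n, hn⟩
    exact measure_eq_zero_iff_ae_notMem.1 (hcount.measure_zero volume)
  have hinj := hF.injective
  have hdiff : Differentiable ℝ G := fun x => (hGd x).differentiableAt
  have hmono : StrictMono G := (monotone_of_deriv_nonneg hdiff (fun x => by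
    rw [(hGd x).deriv]; exact hp0 x)).strictMono_of_injective hinj
  have hFc : Continuous F := (hmono.orderIsoOfRightInverse G F hF').symm.continuous
  have hGT : G θ0 = 0 := by rw [hG]; simp
  -- bounds
  have hmin : 0 < min K1 K3 := lt_min hK1 hK3
  have hc0 : ∀ x, √(min K1 K3) ≤ c x := by
    intro x
    rw [hc]
    apply Real.sqrt_le_sqrt
    have h1 := Real.sin_sq_add_cos_sq x
    have h2 := mul_le_mul_of_nonneg_right (min_le_left K1 K3) (sq_nonneg (Real.cos x))
    have h3 := mul_le_mul_of_nonneg_right (min_le_right K1 K3) (sq_nonneg (Real.sin x))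
    nlinarith
  have hc1 : ∀ x, c x ≤ √(K1 + K3) := by
    intro x
    rw [hc]
    apply Real.sqrt_le_sqrt
    have h1 := Real.sin_sq_le_one x
    have h2 := Real.cos_sq_le_one x
    nlinarith
  have hcpos : ∀ x, 0 < c x := fun x => (Real.sqrt_pos.2 hmin).trans_le (hc0 x)
  obtain ⟨B, hB⟩ : ∃ B, ∀ x, g x ≤ B := by
    refine ⟨|α1| + |(α5 - α2) / 2| + |(α3 + α6) / 2| + |α4 / 2|, fun x => ?_⟩
    rw [hg]
    have h1 := Real.sin_sq_le_one x
    have h2 := Real.cos_sq_le_one x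
    have aux : ∀ a y : ℝ, 0 ≤ y → y ≤ 1 → a * y ≤ |a| := fun a y h0 h1 =>
      (mul_le_mul_of_nonneg_right (le_abs_self a) h0).trans (mul_le_of_le_one_right (abs_nonneg a) h1)
    have h3 : Real.sin x ^ 2 * Real.cos x ^ 2 ≤ 1 := mul_le_one₀ h1 (sq_nonneg _) h2
    have a1 := aux α1 _ (by positivity) h3
    have a2 := aux ((α5 - α2) / 2) _ (sq_nonneg _) h1
    have a3 := aux ((α3 + α6) / 2) _ (sq_nonneg _) h2
    have a4 := le_abs_self (α4 / 2)
    rw [mul_assoc α1]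
    linarith
  have hBpos : 0 < B := (hgpos 0).trans_le (hB 0)
  set k1 : ℝ → ℝ := fun x => (c x * g x) / g x with hk1
  set k2 : ℝ → ℝ := fun x => c x / g x with hk2
  have hk1' : ∀ x, k1 x = c x := fun x => mul_div_cancel_right₀ _ (hgpos x).ne'
  have k1c : Continuous k1 := (hcc.mul hgc).div hgc fun x => (hgpos x).ne'
  have k2c : Continuous k2 := hcc.div hgc fun x => (hgpos x).ne'
  have k1u : ∀ x, |k1 x| ≤ √(K1 + K3) := fun x => by
    rw [hk1', abs_of_pos (hcpos x)]; exact hc1 x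
  have k2u : ∀ x, |k2 x| ≤ √(K1 + K3) / Cbar := fun x => by
    rw [abs_of_pos (div_pos (hcpos x) (hgpos x))]
    exact div_le_div₀ (Real.sqrt_nonneg _) (hc1 x) hCbar (hgC x)
  have k1l : ∀ x, √(min K1 K3) ≤ k1 x := fun x => by rw [hk1']; exact hc0 x
  have k2l : ∀ x, √(min K1 K3) / B ≤ k2 x := fun x =>
    div_le_div₀ (hcpos x).le (hc0 x) (hgpos x) (hB x)
  have k10 : 0 < √(min K1 K3) := Real.sqrt_pos.2 hmin
  have k20 : 0 < √(min K1 K3) / B := by positivity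
  set P : ℝ → ℝ := fun ψ => auxPhi G k1 θ0 ψ * auxPhi G k2 θ0 ψ with hPdef
  have hDP : ∀ ψ, ψ < θ0 → D (-G ψ) = P ψ := by
    intro ψ hψ
    rw [hD]
    have a1 := aux_cov (w := fun x => c x * g x) hgpos hGd hp0 hnull hF ψ θ0 hψ hGT
    have a2 := aux_cov (w := c) hgpos hGd hp0 hnull hF ψ θ0 hψ hGT
    rw [a1, a2]
  have hpp : ∀ x ∈ Ioo e' e, 0 < h x / g x := fun x hx =>
    div_pos (lt_of_le_of_ne (hh0 x) (hcons x hx).symm) (hgpos x)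
  have hPc : ∀ x ∈ Ioo e' e, ContinuousAt P x := fun x hx =>
    (aux_cont hpc hGd hp0 k1c _ k1u x θ0 (hx.2.trans heθ0) (hpp x hx)).mul
      (aux_cont hpc hGd hp0 k2c _ k2u x θ0 (hx.2.trans heθ0) (hpp x hx))
  have hPpos : ∀ x ∈ Ioo e' e, 0 < P x := by
    intro x hx
    have hxT := hx.2.trans heθ0
    refine mul_pos ?_ ?_
    · refine intervalIntegral.intervalIntegral_pos_of_pos_on
        (aux_int hpc hGd hp0 k1c _ k1u x θ0 hxT (hpp x hx)) (fun y hy => ?_) hxT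
      exact div_pos (k10.trans_le (k1l y)) (Real.sqrt_pos.2 (sub_pos.2 (hmono hy.1)))
    · refine intervalIntegral.intervalIntegral_pos_of_pos_on
        (aux_int hpc hGd hp0 k2c _ k2u x θ0 hxT (hpp x hx)) (fun y hy => ?_) hxT
      exact div_pos (k20.trans_le (k2l y)) (Real.sqrt_pos.2 (sub_pos.2 (hmono hy.1)))
  have ht : ∀ z, h z = 0 → z ∉ Ioo e' e → z < θ0 → Tendsto P (nhdsWithin z (Ioo e' e)) atTop :=
    fun z hz hzS hzT => aux_tend hpc hGd hp0 hinj k1c _ _ k1u k10 k1l k2c _ _ k2u k20 k2l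
      (Ioo e' e) θ0 hpp _ z hM (hpquad z hz) hzS hzT
  have hmemF : ∀ β ∈ Ioo (-G e) (-G e'), F (-β) ∈ Ioo e' e ∧ β = -G (F (-β)) := by
    intro β hβ
    have h1 : G (F (-β)) = -β := hF' _
    refine ⟨⟨hmono.lt_iff_lt.1 ?_, hmono.lt_iff_lt.1 ?_⟩, ?_⟩
    · rw [h1]; linarith [hβ.2]
    · rw [h1]; linarith [hβ.1]
    · rw [h1, neg_neg]
  have hmemG : ∀ ψ ∈ Ioo e' e, -G ψ ∈ Ioo (-G e) (-G e') := fun ψ hψ =>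
    ⟨neg_lt_neg (hmono hψ.2), neg_lt_neg (hmono hψ.1)⟩
  have hDF : ∀ β ∈ Ioo (-G e) (-G e'), D β = P (F (-β)) := by
    intro β hβ
    obtain ⟨h1, h2⟩ := hmemF β hβ
    rw [← hDP _ (h1.2.trans heθ0), ← h2]
  obtain ⟨x0, hx0, hx0min, htwo⟩ := aux_final he'e (fun x hx => (hPc x hx).continuousWithinAt)
    (ht e' he' (fun h => lt_irrefl _ h.1) (he'e.trans heθ0))
    (ht e he (fun h => lt_irrefl _ h.2) heθ0)
  have hle : ∀ β ∈ Ioo (-G e) (-G e'), P x0 ≤ D β := fun β hβ => by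
    rw [hDF β hβ]; exact hx0min _ (hmemF β hβ).1
  refine ⟨?_, P x0, hPpos x0 hx0, ⟨-G x0, hmemG _ hx0, hDP _ (hx0.2.trans heθ0)⟩, hle, ?_, ?_⟩
  · refine ContinuousOn.congr (f := fun β => P (F (-β))) ?_ hDF
    intro β hβ
    have : ContinuousAt (fun β => F (-β)) β := (hFc.comp continuous_neg).continuousAt
    exact (ContinuousAt.comp (f := fun β => F (-β)) (g := P) (hPc _ (hmemF β hβ).1) this).continuousWithinAt
  · rintro ub - hub ⟨β, hβ, hβ2⟩
    linarith [hle β hβ]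
  · intro ub hub
    obtain ⟨x1, hx1, x2, hx2, hlt, e1, e2⟩ := htwo (ub / 2) (by linarith)
    refine ⟨-G x1, hmemG _ hx1, -G x2, hmemG _ hx2, ?_, ?_, ?_⟩
    · exact fun h => hlt.ne (hinj (neg_injective h))
    · rw [hDP _ (hx1.2.trans heθ0), e1]; ring
    · rw [hDP _ (hx2.2.trans heθ0), e2]; ring
end
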